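/- arXiv:2105.05084 — 2 statements merged into one kernel-verified Lean document; each statement's English description precedes it below -/
import Mathlib

section
/- For every 0 < a < b and every M > 0 there exist constants 0 < C₁ ≤ C₂ < ∞ such that for all (t, x), (s, y) ∈ [a, b] × [−M, M]^N one has C₁(|t − s| + |x − y|)^{2α} ≤ ∫_ℝ ∫_{ℝ^N} |𝒢_{t,x}(τ, ξ) − 𝒢_{s,y}(τ, ξ)|² |τ|^{1−2H} h_β(ξ) dξ dτ ≤ C₂(|t − s| + |x − y|)^{2α}. (Equivalently, the variance of the increment u(t,x) − u(s,y) of the solution of the stochastic wave equation is comparable to (|t−s|+|x−y|)^{2α}.) -/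
open MeasureTheory Set
open scoped ENNReal

/-- The time–space Fourier transform `𝒢_{t,x}(τ, ξ)` of the wave kernel
`g_{t,x}(s, y) = G(t − s, x − y) 1_{[0,t]}(s)`. -/
noncomputable def Gker (N : ℕ) (t : ℝ) (x : EuclideanSpace ℝ (Fin N)) (τ : ℝ)
    (ξ : EuclideanSpace ℝ (Fin N)) : ℂ :=
  (Complex.exp (-Complex.I * ((inner ℝ x ξ : ℝ) : ℂ)) / (2 * (‖ξ‖ : ℂ))) *
    ((Complex.exp (-Complex.I * (t : ℂ) * (τ : ℂ)) -
        Complex.exp (Complex.I * (t : ℂ) * (‖ξ‖ : ℂ))) / ((τ : ℂ) + (‖ξ‖ : ℂ)) -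
      (Complex.exp (-Complex.I * (t : ℂ) * (τ : ℂ)) -
        Complex.exp (-Complex.I * (t : ℂ) * (‖ξ‖ : ℂ))) / ((τ : ℂ) - (‖ξ‖ : ℂ)))

/-- The spectral integral `∫_ℝ ∫_{ℝ^N} |f(τ,ξ)|² |τ|^{1−2H} h_β(ξ) dξ dτ`, which (up to a
positive constant) gives the variance of the corresponding linear functional of the solution. -/
noncomputable def specInt (N : ℕ) (H : ℝ) (hfun : EuclideanSpace ℝ (Fin N) → ℝ)
    (f : ℝ → EuclideanSpace ℝ (Fin N) → ℂ) : ℝ≥0∞ :=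
  ∫⁻ τ : ℝ, ∫⁻ ξ : EuclideanSpace ℝ (Fin N),
    ENNReal.ofReal (‖f τ ξ‖ ^ 2 * |τ| ^ (1 - 2 * H) * hfun ξ)


lemma aux_int {E : Type*} [NormedAddCommGroup E] [NormedSpace ℝ E] [MeasurableSpace E]
    [BorelSpace E] [FiniteDimensional ℝ E] [Nontrivial E] (μ : Measure E) [μ.IsAddHaarMeasure]
    (p : ℝ) (h1 : p < Module.finrank ℝ E) (h2 : (Module.finrank ℝ E : ℝ) < p + 2) :
    Integrable (fun η : E => (1 + ‖η‖) ^ (-2 : ℝ) * ‖η‖ ^ (-p)) μ := by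
  have hn : 0 < Module.finrank ℝ E := Module.finrank_pos
  set n := Module.finrank ℝ E with hnn
  refine (integrable_fun_norm_addHaar (F := ℝ) μ
    (f := fun y => (1 + y) ^ (-2 : ℝ) * y ^ (-p))).2 ?_
  rw [← hnn]
  have hcast : ((n - 1 : ℕ) : ℝ) = (n : ℝ) - 1 := by
    rw [Nat.cast_sub hn]; simp
  have hU : Ioi (0 : ℝ) = Ioc 0 1 ∪ Ioi 1 := (Ioc_union_Ioi_eq_Ioi zero_le_one).symm
  have hm : ∀ s : Set ℝ, AEStronglyMeasurable
      (fun y : ℝ => y ^ (n - 1) • ((1 + y) ^ (-2 : ℝ) * y ^ (-p))) (volume.restrict s) := by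
    intro s
    apply Measurable.aestronglyMeasurable
    fun_prop
  rw [hU]
  apply IntegrableOn.union
  · have hi : IntegrableOn (fun y : ℝ => y ^ ((n : ℝ) - 1 - p)) (Ioc 0 1) := by
      rw [integrableOn_Ioc_iff_integrableOn_Ioo]
      exact (intervalIntegral.integrableOn_Ioo_rpow_iff one_pos).2 (by linarith)
    refine Integrable.mono' hi (hm _) ?_
    filter_upwards [ae_restrict_mem measurableSet_Ioc] with y hy
    have hy0 : 0 < y := hy.1
    have : (1 + y) ^ (-2 : ℝ) ≤ 1 := Real.rpow_le_one_of_one_le_of_nonpos (by linarith) (by norm_num)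
    rw [smul_eq_mul, Real.norm_of_nonneg (by positivity)]
    calc y ^ (n - 1) * ((1 + y) ^ (-2 : ℝ) * y ^ (-p)) ≤ y ^ (n - 1) * (1 * y ^ (-p)) := by gcongr
      _ = y ^ ((n : ℝ) - 1 - p) := by
        rw [one_mul, ← Real.rpow_natCast, ← Real.rpow_add hy0, hcast]; ring_nf
  · have hi : IntegrableOn (fun y : ℝ => y ^ ((n : ℝ) - 1 - 2 - p)) (Ioi 1) :=
      integrableOn_Ioi_rpow_of_lt (by linarith) one_pos
    refine Integrable.mono' hi (hm _) ?_
    filter_upwards [ae_restrict_mem measurableSet_Ioi] with y hy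
    have hy0 : 0 < y := lt_trans one_pos hy
    have : (1 + y) ^ (-2 : ℝ) ≤ y ^ (-2 : ℝ) :=
      Real.rpow_le_rpow_of_nonpos hy0 (by linarith) (by norm_num)
    rw [smul_eq_mul, Real.norm_of_nonneg (by positivity)]
    calc y ^ (n - 1) * ((1 + y) ^ (-2 : ℝ) * y ^ (-p))
        ≤ y ^ (n - 1) * (y ^ (-2 : ℝ) * y ^ (-p)) := by gcongr
      _ = y ^ ((n : ℝ) - 1 - 2 - p) := by
        rw [← Real.rpow_natCast, ← Real.rpow_add hy0, ← Real.rpow_add hy0, hcast]; ring_nf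

lemma aux_scale {E : Type*} [NormedAddCommGroup E] [NormedSpace ℝ E] [MeasurableSpace E]
    [BorelSpace E] [FiniteDimensional ℝ E] (μ : Measure E) [μ.IsAddHaarMeasure]
    (p δ : ℝ) (hδ : 0 < δ) :
    ∫⁻ ξ : E, ENNReal.ofReal ((1 + δ * ‖ξ‖) ^ (-2 : ℝ) * ‖ξ‖ ^ (-p)) ∂μ =
      ENNReal.ofReal (δ ^ (p - Module.finrank ℝ E)) *
        ∫⁻ ξ : E, ENNReal.ofReal ((1 + ‖ξ‖) ^ (-2 : ℝ) * ‖ξ‖ ^ (-p)) ∂μ := by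
  have h := Measure.map_addHaar_smul μ hδ.ne'
  have h2 : ∫⁻ ξ : E, ENNReal.ofReal ((1 + ‖ξ‖) ^ (-2 : ℝ) * ‖ξ‖ ^ (-p))
      ∂(Measure.map (fun x => δ • x) μ) =
      ∫⁻ ξ : E, ENNReal.ofReal ((1 + ‖δ • ξ‖) ^ (-2 : ℝ) * ‖δ • ξ‖ ^ (-p)) ∂μ := by
    apply lintegral_map
    · fun_prop
    · fun_prop
  rw [h, lintegral_smul_measure] at h2
  have h3 : ∀ ξ : E, ENNReal.ofReal ((1 + δ * ‖ξ‖) ^ (-2 : ℝ) * ‖ξ‖ ^ (-p)) =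
      ENNReal.ofReal (δ ^ p) *
        ENNReal.ofReal ((1 + ‖δ • ξ‖) ^ (-2 : ℝ) * ‖δ • ξ‖ ^ (-p)) := by
    intro ξ
    rw [← ENNReal.ofReal_mul (by positivity), norm_smul, Real.norm_of_nonneg hδ.le,
      Real.mul_rpow hδ.le (norm_nonneg _), Real.rpow_neg hδ.le p]
    congr 1
    have : δ ^ p ≠ 0 := by positivity
    field_simp
  simp_rw [h3]
  rw [lintegral_const_mul' _ _ ENNReal.ofReal_ne_top, ← h2, smul_eq_mul, ← mul_assoc,
    ← ENNReal.ofReal_mul (by positivity)]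
  congr 2
  rw [abs_of_pos (by positivity), Real.rpow_sub hδ, Real.rpow_natCast, div_eq_mul_inv]

lemma aux_K (γ : ℝ) (h0 : 0 ≤ γ) (h1 : γ < 1) : ∃ K : ℝ, 0 ≤ K ∧ ∀ ρ : ℝ, ρ ≠ 0 →
    ∫⁻ τ : ℝ, ENNReal.ofReal ((1 + |τ - ρ|) ^ (-2 : ℝ) * |τ| ^ (-γ)) ≤
      ENNReal.ofReal (K * |ρ| ^ (-γ)) := by
  have i1 : Integrable (fun θ : ℝ => (1 + ‖θ‖) ^ (-(2 - γ))) volume :=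
    integrable_one_add_norm (by simp; linarith)
  have i2 : Integrable (fun θ : ℝ => (1 + ‖θ‖) ^ (-2 : ℝ) * ‖θ‖ ^ (-γ)) volume :=
    aux_int volume γ (by simpa using h1) (by simp; linarith)
  set A := ∫ θ : ℝ, (1 + ‖θ‖) ^ (-(2 - γ)) with hA
  set B := ∫ θ : ℝ, (1 + ‖θ‖) ^ (-2 : ℝ) * ‖θ‖ ^ (-γ) with hB
  have hA0 : 0 ≤ A := integral_nonneg (fun θ => by positivity)
  have hB0 : 0 ≤ B := integral_nonneg (fun θ => by positivity)
  have eA : ∫⁻ θ : ℝ, ENNReal.ofReal ((1 + ‖θ‖) ^ (-(2 - γ))) = ENNReal.ofReal A :=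
    (ofReal_integral_eq_lintegral_ofReal i1 (ae_of_all _ fun θ => by positivity)).symm
  have eB : ∫⁻ θ : ℝ, ENNReal.ofReal ((1 + ‖θ‖) ^ (-2 : ℝ) * ‖θ‖ ^ (-γ)) = ENNReal.ofReal B :=
    (ofReal_integral_eq_lintegral_ofReal i2 (ae_of_all _ fun θ => by positivity)).symm
  refine ⟨2 * A + 4 * B, by positivity, fun ρ hρ => ?_⟩
  have hρ0 : 0 < |ρ| := abs_pos.2 hρ
  have key : ∀ τ : ℝ, τ ≠ 0 → (1 + |τ - ρ|) ^ (-2 : ℝ) * |τ| ^ (-γ) ≤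
      |ρ| ^ (-γ) * (2 * (1 + ‖τ - ρ‖) ^ (-(2 - γ)) + 4 * ((1 + ‖τ‖) ^ (-2 : ℝ) * ‖τ‖ ^ (-γ))) := by
    intro τ hτ
    simp only [Real.norm_eq_abs]
    have hτ0 : 0 < |τ| := abs_pos.2 hτ
    set θ := |τ - ρ| with hθ
    have hθ0 : 0 ≤ θ := abs_nonneg _
    have hsub : |ρ| ^ γ ≤ |τ| ^ γ + θ ^ γ := by
      refine le_trans ?_ (Real.rpow_add_le_add_rpow hτ0.le hθ0 h0 h1.le)
      apply Real.rpow_le_rpow hρ0.le _ h0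
      have := abs_sub_abs_le_abs_sub ρ τ
      rw [abs_sub_comm] at this
      linarith
    have e1 : (1 + θ) ^ (-(2 - γ)) = (1 + θ) ^ (-2 : ℝ) * (1 + θ) ^ γ := by
      rw [← Real.rpow_add (by positivity)]; ring_nf
    have g1 : 1 ≤ (1 + θ) ^ γ := Real.one_le_rpow (by linarith) h0
    have g2 : θ ^ γ ≤ (1 + θ) ^ γ := Real.rpow_le_rpow hθ0 (by linarith) h0
    have hm0 : 0 < (1 + θ) ^ (-2 : ℝ) := by positivity
    have hW1 : (1 + θ) ^ (-(2 - γ)) ≤ 1 :=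
      Real.rpow_le_one_of_one_le_of_nonpos (by linarith) (by linarith)
    have hW0 : 0 < (1 + θ) ^ (-(2 - γ)) := by positivity
    have hT0 : 0 < |τ| ^ (-γ) := by positivity
    have hTT : |τ| ^ (-γ) * |τ| ^ γ = 1 := by
      rw [← Real.rpow_add hτ0]; simp
    have hR0 : 0 < |ρ| ^ γ := by positivity
    have main : (1 + θ) ^ (-2 : ℝ) * |τ| ^ (-γ) * |ρ| ^ γ ≤
        2 * (1 + θ) ^ (-(2 - γ)) + 4 * ((1 + |τ|) ^ (-2 : ℝ) * |τ| ^ (-γ)) := by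
      have s1 : (1 + θ) ^ (-2 : ℝ) * |τ| ^ (-γ) * |ρ| ^ γ ≤
          (1 + θ) ^ (-(2 - γ)) * (1 + |τ| ^ (-γ)) := by
        calc (1 + θ) ^ (-2 : ℝ) * |τ| ^ (-γ) * |ρ| ^ γ
            ≤ (1 + θ) ^ (-2 : ℝ) * |τ| ^ (-γ) * (|τ| ^ γ + θ ^ γ) := by gcongr
          _ = (1 + θ) ^ (-2 : ℝ) * (1 + |τ| ^ (-γ) * θ ^ γ) := by
              linear_combination (1 + θ) ^ (-2 : ℝ) * hTT
          _ ≤ (1 + θ) ^ (-2 : ℝ) * ((1 + θ) ^ γ + |τ| ^ (-γ) * (1 + θ) ^ γ) := by gcongr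
          _ = _ := by rw [e1]; ring
      rcases le_total 1 |τ| with h | h
      · have : |τ| ^ (-γ) ≤ 1 := Real.rpow_le_one_of_one_le_of_nonpos h (by linarith)
        have : 0 ≤ (1 + |τ|) ^ (-2 : ℝ) * |τ| ^ (-γ) := by positivity
        nlinarith
      · have h4 : (1 : ℝ) ≤ 4 * (1 + |τ|) ^ (-2 : ℝ) := by
          rw [Real.rpow_neg (by positivity), ← div_eq_mul_inv, le_div_iff₀ (by positivity)]
          norm_num
          nlinarith
        nlinarith [mul_le_mul_of_nonneg_right h4 hT0.le, mul_le_mul_of_nonneg_right hW1 hT0.le]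
    rw [Real.rpow_neg hρ0.le, ← div_eq_inv_mul, le_div_iff₀ hR0]
    exact main
  have hae : ∀ᵐ τ : ℝ, τ ≠ 0 := by
    simp [ae_iff]
  calc ∫⁻ τ : ℝ, ENNReal.ofReal ((1 + |τ - ρ|) ^ (-2 : ℝ) * |τ| ^ (-γ))
      ≤ ∫⁻ τ : ℝ, ENNReal.ofReal (|ρ| ^ (-γ)) * (ENNReal.ofReal 2 * ENNReal.ofReal ((1 + ‖τ - ρ‖) ^ (-(2 - γ)))
          + ENNReal.ofReal 4 * ENNReal.ofReal ((1 + ‖τ‖) ^ (-2 : ℝ) * ‖τ‖ ^ (-γ))) := by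
        apply lintegral_mono_ae
        filter_upwards [hae] with τ hτ
        rw [← ENNReal.ofReal_mul (by norm_num), ← ENNReal.ofReal_mul (by norm_num),
          ← ENNReal.ofReal_add (by positivity) (by positivity), ← ENNReal.ofReal_mul (by positivity)]
        exact ENNReal.ofReal_le_ofReal (key τ hτ)
    _ = ENNReal.ofReal ((2 * A + 4 * B) * |ρ| ^ (-γ)) := by
        rw [lintegral_const_mul' _ _ ENNReal.ofReal_ne_top, lintegral_add_left (by fun_prop),
          lintegral_const_mul' _ _ ENNReal.ofReal_ne_top, lintegral_const_mul' _ _ ENNReal.ofReal_ne_top,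
          lintegral_sub_right_eq_self (fun τ : ℝ => ENNReal.ofReal ((1 + ‖τ‖) ^ (-(2 - γ)))) ρ, eA, eB,
          ← ENNReal.ofReal_mul (by norm_num), ← ENNReal.ofReal_mul (by norm_num),
          ← ENNReal.ofReal_add (by positivity) (by positivity), ← ENNReal.ofReal_mul (by positivity),
          mul_comm]

/-- The building block `(e^{-itτ} - e^{itρ})/(τ+ρ)`. -/
noncomputable def Fker (t τ ρ : ℝ) : ℂ :=
  (Complex.exp (Complex.I * ((-(t * τ) : ℝ) : ℂ)) - Complex.exp (Complex.I * ((t * ρ : ℝ) : ℂ))) /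
    ((τ + ρ : ℝ) : ℂ)

lemma Gker_eq (N : ℕ) (t : ℝ) (x : EuclideanSpace ℝ (Fin N)) (τ : ℝ)
    (ξ : EuclideanSpace ℝ (Fin N)) :
    Gker N t x τ ξ = Complex.exp (Complex.I * ((-(inner ℝ x ξ) : ℝ) : ℂ)) / (2 * (‖ξ‖ : ℂ)) *
      (Fker t τ ‖ξ‖ - Fker t τ (-‖ξ‖)) := by
  unfold Gker Fker
  push_cast
  ring_nf

lemma exp_diff_le (u v : ℝ) :
    ‖Complex.exp (Complex.I * (u : ℂ)) - Complex.exp (Complex.I * (v : ℂ))‖ ≤ |u - v| := by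
  have h : Complex.exp (Complex.I * (u : ℂ)) - Complex.exp (Complex.I * (v : ℂ)) =
      Complex.exp (Complex.I * (v : ℂ)) * (Complex.exp (Complex.I * ((u - v : ℝ) : ℂ)) - 1) := by
    rw [mul_sub, ← Complex.exp_add, mul_one]
    congr 2
    push_cast; ring
  rw [h, norm_mul, Complex.norm_exp_I_mul_ofReal, one_mul]
  exact Real.norm_exp_I_mul_ofReal_sub_one_le

lemma exp_diff_le_two (u v : ℝ) :
    ‖Complex.exp (Complex.I * (u : ℂ)) - Complex.exp (Complex.I * (v : ℂ))‖ ≤ 2 := by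
  refine (norm_sub_le _ _).trans ?_
  rw [Complex.norm_exp_I_mul_ofReal, Complex.norm_exp_I_mul_ofReal]; norm_num

lemma Fker_le (b t τ ρ : ℝ) (ht : 0 ≤ t) (htb : t ≤ b) :
    ‖Fker t τ ρ‖ ≤ (b + 2) * (1 + |τ + ρ|)⁻¹ := by
  unfold Fker
  rw [norm_div, Complex.norm_real, Real.norm_eq_abs]
  set X := ‖Complex.exp (Complex.I * ((-(t * τ) : ℝ) : ℂ)) - Complex.exp (Complex.I * ((t * ρ : ℝ) : ℂ))‖
    with hX
  have h1 : X ≤ t * |τ + ρ| := by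
    refine (exp_diff_le _ _).trans (le_of_eq ?_)
    rw [show -(t * τ) - t * ρ = -(t * (τ + ρ)) by ring, abs_neg, abs_mul, abs_of_nonneg ht]
  have h2 : X ≤ 2 := exp_diff_le_two _ _
  rcases (abs_nonneg (τ + ρ)).eq_or_lt with h | h
  · rw [← h]; simp; linarith
  · rw [← div_eq_mul_inv, div_le_div_iff₀ h (by positivity)]
    nlinarith [mul_le_mul_of_nonneg_right htb h.le]

lemma Fker_le_two (t τ ρ : ℝ) (h : 0 < τ + ρ) : ‖Fker t τ ρ‖ ≤ 2 / (τ + ρ) := by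
  unfold Fker
  rw [norm_div, Complex.norm_real, Real.norm_eq_abs, abs_of_pos h]
  gcongr
  exact exp_diff_le_two _ _

lemma Fker_deriv (τ ρ t : ℝ) (h : τ + ρ ≠ 0) :
    HasDerivAt (fun t : ℝ => Fker t τ ρ)
      (Complex.I * ρ * Fker t τ ρ - Complex.I * Complex.exp (Complex.I * ((-(t * τ) : ℝ) : ℂ))) t := by
  have hc : ((τ + ρ : ℝ) : ℂ) ≠ 0 := by exact_mod_cast h
  have d1 : HasDerivAt (fun t : ℝ => Complex.exp (Complex.I * ((-(t * τ) : ℝ) : ℂ)))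
      (Complex.exp (Complex.I * ((-(t * τ) : ℝ) : ℂ)) * (Complex.I * ((-(1 * τ) : ℝ) : ℂ))) t :=
    ((((hasDerivAt_id t).mul_const τ).neg.ofReal_comp).const_mul Complex.I).cexp
  have d2 : HasDerivAt (fun t : ℝ => Complex.exp (Complex.I * ((t * ρ : ℝ) : ℂ)))
      (Complex.exp (Complex.I * ((t * ρ : ℝ) : ℂ)) * (Complex.I * ((1 * ρ : ℝ) : ℂ))) t :=
    ((((hasDerivAt_id t).mul_const ρ).ofReal_comp).const_mul Complex.I).cexp
  have := (d1.sub d2).div_const ((τ + ρ : ℝ) : ℂ)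
  refine this.congr_deriv ?_
  unfold Fker
  field_simp
  push_cast
  ring

lemma Gker_time (N : ℕ) (b t s : ℝ) (x : EuclideanSpace ℝ (Fin N)) (τ : ℝ)
    (ξ : EuclideanSpace ℝ (Fin N)) (hξ : ξ ≠ 0) (h1 : τ + ‖ξ‖ ≠ 0) (h2 : τ + -‖ξ‖ ≠ 0)
    (ht : t ∈ Icc 0 b) (hs : s ∈ Icc 0 b) :
    ‖Gker N t x τ ξ - Gker N s x τ ξ‖ ≤
      ((b + 2) * ((1 + |τ + ‖ξ‖|)⁻¹ + (1 + |τ + -‖ξ‖|)⁻¹)) / 2 * |t - s| := by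
  have hr : (‖ξ‖ : ℂ) ≠ 0 := by exact_mod_cast (norm_pos_iff.2 hξ).ne'
  set E := Complex.exp (Complex.I * ((-(inner ℝ x ξ) : ℝ) : ℂ)) with hE
  have hEn : ‖E‖ = 1 := Complex.norm_exp_I_mul_ofReal _
  have := Convex.norm_image_sub_le_of_norm_hasDerivWithin_le (𝕜 := ℝ) (f := fun t => Gker N t x τ ξ)
    (f' := fun t => E * Complex.I / 2 * (Fker t τ ‖ξ‖ + Fker t τ (-‖ξ‖))) (s := Icc 0 b)
    (x := s) (y := t)
    (C := ((b + 2) * ((1 + |τ + ‖ξ‖|)⁻¹ + (1 + |τ + -‖ξ‖|)⁻¹)) / 2) ?_ ?_ (convex_Icc _ _) hs ht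
  · simpa [Real.norm_eq_abs] using this
  · intro u hu
    apply HasDerivAt.hasDerivWithinAt
    simp_rw [Gker_eq]
    refine (((Fker_deriv τ ‖ξ‖ u h1).sub (Fker_deriv τ (-‖ξ‖) u h2)).const_mul
      (E / (2 * (‖ξ‖ : ℂ)))).congr_deriv ?_
    field_simp
    push_cast
    ring
  · intro u hu
    have a1 := Fker_le b u τ ‖ξ‖ hu.1 hu.2
    have a2 := Fker_le b u τ (-‖ξ‖) hu.1 hu.2
    rw [norm_mul, norm_div, norm_mul, hEn, Complex.norm_I]
    have := norm_add_le (Fker u τ ‖ξ‖) (Fker u τ (-‖ξ‖))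
    norm_num
    linarith

lemma Gker_size (N : ℕ) (b t : ℝ) (x : EuclideanSpace ℝ (Fin N)) (τ : ℝ)
    (ξ : EuclideanSpace ℝ (Fin N)) (hξ : ξ ≠ 0) (ht : t ∈ Icc 0 b) :
    ‖Gker N t x τ ξ‖ * ‖ξ‖ ≤ ((b + 2) * ((1 + |τ + ‖ξ‖|)⁻¹ + (1 + |τ + -‖ξ‖|)⁻¹)) / 2 := by
  have hr : 0 < ‖ξ‖ := norm_pos_iff.2 hξ
  have a1 := Fker_le b t τ ‖ξ‖ ht.1 ht.2
  have a2 := Fker_le b t τ (-‖ξ‖) ht.1 ht.2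
  have a3 := norm_sub_le (Fker t τ ‖ξ‖) (Fker t τ (-‖ξ‖))
  rw [Gker_eq, norm_mul, norm_div, Complex.norm_exp_I_mul_ofReal, norm_mul, Complex.norm_real,
    norm_norm]
  norm_num
  have : ‖ξ‖⁻¹ * (1 / 2) * ‖Fker t τ ‖ξ‖ - Fker t τ (-‖ξ‖)‖ * ‖ξ‖ =
    ‖Fker t τ ‖ξ‖ - Fker t τ (-‖ξ‖)‖ / 2 := by field_simp
  rw [this]
  linarith

lemma Gker_space (N : ℕ) (t : ℝ) (x y : EuclideanSpace ℝ (Fin N)) (τ : ℝ)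
    (ξ : EuclideanSpace ℝ (Fin N)) :
    ‖Gker N t x τ ξ - Gker N t y τ ξ‖ ≤ ‖x - y‖ * (‖Gker N t x τ ξ‖ * ‖ξ‖) := by
  have hG : ‖Gker N t x τ ξ‖ = ‖(2 * (‖ξ‖ : ℂ))⁻¹ * (Fker t τ ‖ξ‖ - Fker t τ (-‖ξ‖))‖ := by
    rw [Gker_eq, div_eq_mul_inv, mul_assoc, norm_mul, Complex.norm_exp_I_mul_ofReal, one_mul]
  rw [hG]
  have : Gker N t x τ ξ - Gker N t y τ ξ =
      (Complex.exp (Complex.I * ((-(inner ℝ x ξ) : ℝ) : ℂ)) -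
        Complex.exp (Complex.I * ((-(inner ℝ y ξ) : ℝ) : ℂ))) *
        ((2 * (‖ξ‖ : ℂ))⁻¹ * (Fker t τ ‖ξ‖ - Fker t τ (-‖ξ‖))) := by
    rw [Gker_eq, Gker_eq]; ring
  rw [this, norm_mul]
  have h := exp_diff_le (-(inner ℝ x ξ)) (-(inner ℝ y ξ))
  have h' : |-(inner ℝ x ξ) - -(inner ℝ y ξ)| ≤ ‖x - y‖ * ‖ξ‖ := by
    rw [show -(inner ℝ x ξ) - -(inner ℝ y ξ) = -(inner ℝ (x - y) ξ) by
      rw [inner_sub_left]; ring, abs_neg]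
    exact abs_real_inner_le_norm _ _
  calc _ ≤ (‖x - y‖ * ‖ξ‖) * ‖(2 * (‖ξ‖ : ℂ))⁻¹ * (Fker t τ ‖ξ‖ - Fker t τ (-‖ξ‖))‖ := by
        gcongr; exact h.trans h'
    _ = _ := by ring

lemma Gker_incr (N : ℕ) (b t s : ℝ) (x y : EuclideanSpace ℝ (Fin N)) (τ : ℝ)
    (ξ : EuclideanSpace ℝ (Fin N)) (hξ : ξ ≠ 0) (h1 : τ + ‖ξ‖ ≠ 0) (h2 : τ + -‖ξ‖ ≠ 0)
    (ht : t ∈ Icc 0 b) (hs : s ∈ Icc 0 b) :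
    ‖Gker N t x τ ξ - Gker N s y τ ξ‖ ^ 2 ≤
      8 * (b + 2) ^ 2 * (|t - s| + ‖x - y‖) ^ 2 * (1 + (|t - s| + ‖x - y‖) * ‖ξ‖) ^ (-2 : ℝ) *
       ((1 + |τ - -‖ξ‖|) ^ (-2 : ℝ) + (1 + |τ - ‖ξ‖|) ^ (-2 : ℝ)) := by
  have hr : 0 < ‖ξ‖ := norm_pos_iff.2 hξ
  have hb : 0 ≤ b := ht.1.trans ht.2
  have e1 := Gker_time N b t s x τ ξ hξ h1 h2 ht hs
  have e2 := Gker_size N b t x τ ξ hξ ht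
  have e3 := Gker_size N b s y τ ξ hξ hs
  have e3' := Gker_size N b s x τ ξ hξ hs
  have e4 := Gker_space N s x y τ ξ
  set δ := |t - s| + ‖x - y‖ with hδ
  have hδ0 : 0 ≤ δ := by positivity
  set m1 := (1 + |τ + ‖ξ‖|)⁻¹ with hm1
  set m2 := (1 + |τ + -‖ξ‖|)⁻¹ with hm2
  set P := (b + 2) * (m1 + m2) with hP
  have hP0 : 0 ≤ P := by positivity
  set X := ‖Gker N t x τ ξ - Gker N s y τ ξ‖ with hX
  have f1 : X ≤ P / 2 * δ := by
    have : X ≤ ‖Gker N t x τ ξ - Gker N s x τ ξ‖ + ‖Gker N s x τ ξ - Gker N s y τ ξ‖ :=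
      norm_sub_le_norm_sub_add_norm_sub _ _ _
    have := mul_le_mul_of_nonneg_left e3' (norm_nonneg (x - y))
    rw [hδ]
    linarith
  have f2 : X * ‖ξ‖ ≤ P := by
    have : X ≤ ‖Gker N t x τ ξ‖ + ‖Gker N s y τ ξ‖ := norm_sub_le _ _
    nlinarith
  have f3 : X * (1 + δ * ‖ξ‖) ≤ 2 * P * δ := by
    nlinarith [mul_le_mul_of_nonneg_left f2 hδ0, mul_nonneg hP0 hδ0]
  have f4 : X ≤ 2 * P * δ * (1 + δ * ‖ξ‖)⁻¹ := by
    rw [← div_eq_mul_inv, le_div_iff₀ (by positivity)]; exact f3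
  have hX0 : 0 ≤ X := norm_nonneg _
  have c2 : ∀ z : ℝ, 0 < z → z ^ (-2 : ℝ) = (z⁻¹) ^ 2 := by
    intro z hz
    rw [Real.rpow_neg hz.le, inv_pow]; norm_num
  rw [c2 _ (by positivity), c2 _ (by positivity), c2 _ (by positivity), sub_neg_eq_add,
    sub_eq_add_neg τ ‖ξ‖, ← hm1, ← hm2]
  calc X ^ 2 ≤ (2 * P * δ * (1 + δ * ‖ξ‖)⁻¹) ^ 2 := by gcongr
    _ = 4 * (b + 2) ^ 2 * δ ^ 2 * ((1 + δ * ‖ξ‖)⁻¹) ^ 2 * (m1 + m2) ^ 2 := by rw [hP]; ring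
    _ ≤ 4 * (b + 2) ^ 2 * δ ^ 2 * ((1 + δ * ‖ξ‖)⁻¹) ^ 2 * (2 * (m1 ^ 2 + m2 ^ 2)) := by
        gcongr; nlinarith [sq_nonneg (m1 - m2)]
    _ = _ := by ring

lemma Gker_meas (N : ℕ) (t : ℝ) (x : EuclideanSpace ℝ (Fin N)) :
    Measurable (fun q : ℝ × EuclideanSpace ℝ (Fin N) => Gker N t x q.1 q.2) := by
  unfold Gker
  fun_prop

lemma specInt_swap (N : ℕ) (H : ℝ) (hfun : EuclideanSpace ℝ (Fin N) → ℝ) (hmeas : Measurable hfun)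
    (t s : ℝ) (x y : EuclideanSpace ℝ (Fin N)) :
    specInt N H hfun (fun τ ξ => Gker N t x τ ξ - Gker N s y τ ξ) =
      ∫⁻ ξ : EuclideanSpace ℝ (Fin N), ∫⁻ τ : ℝ,
        ENNReal.ofReal (‖Gker N t x τ ξ - Gker N s y τ ξ‖ ^ 2 * |τ| ^ (1 - 2 * H) * hfun ξ) := by
  unfold specInt
  apply lintegral_lintegral_swap
  apply Measurable.aemeasurable
  have h1 := Gker_meas N t x
  have h2 := Gker_meas N s y
  unfold Function.uncurry
  fun_prop

lemma upper_bound
    (N : ℕ) (hN : 1 ≤ N) (H β : ℝ) (hH1 : 1 / 2 ≤ H) (hH2 : H < 1)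
    (hβlow : (N : ℝ) - 2 * H - 1 < β) (hβup : β < (N : ℝ) - 2 * H + 1)
    (hfun : EuclideanSpace ℝ (Fin N) → ℝ) (hmeas : Measurable hfun)
    (c₂ : ℝ) (hc₂ : 0 < c₂)
    (hfup : ∀ ξ : EuclideanSpace ℝ (Fin N), ξ ≠ 0 → hfun ξ ≤ c₂ * ‖ξ‖ ^ (-β))
    (b : ℝ) (hb : 0 < b) :
    ∃ C₂ : ℝ, 0 ≤ C₂ ∧
      ∀ t s : ℝ, ∀ x y : EuclideanSpace ℝ (Fin N),
        t ∈ Icc 0 b → s ∈ Icc 0 b →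
          specInt N H hfun (fun τ ξ => Gker N t x τ ξ - Gker N s y τ ξ) ≤
            ENNReal.ofReal (C₂ * (|t - s| + ‖x - y‖) ^ (2 * H + 1 - N + β)) := by
  have : Nonempty (Fin N) := ⟨⟨0, hN⟩⟩
  obtain ⟨K, hK0, hK⟩ := aux_K (2 * H - 1) (by linarith) (by linarith)
  set p := β + (2 * H - 1) with hp
  have hfr : (Module.finrank ℝ (EuclideanSpace ℝ (Fin N)) : ℝ) = N := by simp
  have hI := aux_int (volume : Measure (EuclideanSpace ℝ (Fin N))) p
    (by rw [hfr, hp]; linarith) (by rw [hfr, hp]; linarith)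
  set A := ∫ η : EuclideanSpace ℝ (Fin N), (1 + ‖η‖) ^ (-2 : ℝ) * ‖η‖ ^ (-p) with hA
  have hA0 : 0 ≤ A := integral_nonneg (fun θ => by positivity)
  have eA : ∫⁻ η : EuclideanSpace ℝ (Fin N), ENNReal.ofReal ((1 + ‖η‖) ^ (-2 : ℝ) * ‖η‖ ^ (-p))
      = ENNReal.ofReal A :=
    (ofReal_integral_eq_lintegral_ofReal hI (ae_of_all _ fun θ => by positivity)).symm
  refine ⟨16 * (b + 2) ^ 2 * c₂ * K * A, by positivity, fun t s x y ht hs => ?_⟩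
  set δ := |t - s| + ‖x - y‖ with hδ
  have hδ0 : 0 ≤ δ := by positivity
  rcases hδ0.eq_or_lt with h0 | hδ1
  · have h1 : |t - s| = 0 := by linarith [abs_nonneg (t - s), norm_nonneg (x - y)]
    have h2 : ‖x - y‖ = 0 := by linarith [abs_nonneg (t - s), norm_nonneg (x - y)]
    rw [abs_eq_zero, sub_eq_zero] at h1
    rw [norm_eq_zero, sub_eq_zero] at h2
    subst h1 h2
    simp [specInt]
  rw [specInt_swap N H hfun hmeas]
  have hae : ∀ᵐ ξ : EuclideanSpace ℝ (Fin N), ξ ≠ 0 := by simp [ae_iff]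
  calc _ ≤ ∫⁻ ξ : EuclideanSpace ℝ (Fin N), ENNReal.ofReal (16 * (b + 2) ^ 2 * c₂ * K * δ ^ 2) *
        ENNReal.ofReal ((1 + δ * ‖ξ‖) ^ (-2 : ℝ) * ‖ξ‖ ^ (-p)) := by
        apply lintegral_mono_ae
        filter_upwards [hae] with ξ hξ
        have hr : 0 < ‖ξ‖ := norm_pos_iff.2 hξ
        set B := 8 * (b + 2) ^ 2 * δ ^ 2 * (1 + δ * ‖ξ‖) ^ (-2 : ℝ) * (c₂ * ‖ξ‖ ^ (-β)) with hB
        have hB0 : 0 ≤ B := by positivity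
        have hae1 : ∀ᵐ τ : ℝ, τ ≠ ‖ξ‖ := by simp [ae_iff]
        have hae2 : ∀ᵐ τ : ℝ, τ ≠ -‖ξ‖ := by simp [ae_iff]
        calc _ ≤ ∫⁻ τ : ℝ, ENNReal.ofReal B *
              (ENNReal.ofReal ((1 + |τ - -‖ξ‖|) ^ (-2 : ℝ) * |τ| ^ (-(2 * H - 1))) +
               ENNReal.ofReal ((1 + |τ - ‖ξ‖|) ^ (-2 : ℝ) * |τ| ^ (-(2 * H - 1)))) := by
              apply lintegral_mono_ae
              filter_upwards [hae1, hae2] with τ h1 h2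
              rw [← ENNReal.ofReal_add (by positivity) (by positivity), ← ENNReal.ofReal_mul hB0]
              apply ENNReal.ofReal_le_ofReal
              have := Gker_incr N b t s x y τ ξ hξ (fun h => h2 (by linarith))
                (fun h => h1 (by linarith)) ht hs
              rw [← hδ] at this
              calc _ ≤ ‖Gker N t x τ ξ - Gker N s y τ ξ‖ ^ 2 * |τ| ^ (1 - 2 * H) *
                    (c₂ * ‖ξ‖ ^ (-β)) := by gcongr; exact hfup ξ hξ
                _ ≤ (8 * (b + 2) ^ 2 * δ ^ 2 * (1 + δ * ‖ξ‖) ^ (-2 : ℝ) *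
                    ((1 + |τ - -‖ξ‖|) ^ (-2 : ℝ) + (1 + |τ - ‖ξ‖|) ^ (-2 : ℝ))) * |τ| ^ (1 - 2 * H) *
                    (c₂ * ‖ξ‖ ^ (-β)) := by gcongr
                _ = _ := by rw [hB, show -(2 * H - 1) = 1 - 2 * H by ring]; ring
          _ ≤ ENNReal.ofReal B * (ENNReal.ofReal (K * |-‖ξ‖| ^ (-(2 * H - 1))) +
                ENNReal.ofReal (K * |‖ξ‖| ^ (-(2 * H - 1)))) := by
              rw [lintegral_const_mul' _ _ ENNReal.ofReal_ne_top, lintegral_add_left (by fun_prop)]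
              gcongr
              · exact hK _ (by simpa using hξ)
              · exact hK _ hr.ne'
          _ = _ := by
              rw [abs_neg, abs_norm, ← ENNReal.ofReal_add (by positivity) (by positivity),
                ← ENNReal.ofReal_mul hB0, ← ENNReal.ofReal_mul (by positivity)]
              congr 1
              rw [hB, hp, neg_add, Real.rpow_add hr]
              ring
    _ = _ := by
        rw [lintegral_const_mul' _ _ ENNReal.ofReal_ne_top, aux_scale _ _ _ hδ1, eA,
          ← ENNReal.ofReal_mul (by positivity), ← ENNReal.ofReal_mul (by positivity), hfr]
        congr 1
        have : δ ^ (2 * H + 1 - N + β) = δ ^ 2 * δ ^ (p - N) := by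
          rw [← Real.rpow_natCast, ← Real.rpow_add hδ1]
          congr 1
          rw [hp]; push_cast; ring
        rw [this]; ring

lemma Fker_neg_eq (t r σ : ℝ) (hσ : σ ≠ 0) :
    Fker t (r + σ) (-r) = -Complex.I * ((2 * Real.sin (t * σ / 2) / σ : ℝ) : ℂ) *
      Complex.exp (Complex.I * ((-(t * r + t * σ / 2) : ℝ) : ℂ)) := by
  have hc : (σ : ℂ) ≠ 0 := by exact_mod_cast hσ
  unfold Fker
  have h1 : Complex.exp (Complex.I * ((-(t * (r + σ)) : ℝ) : ℂ)) =
      Complex.exp (Complex.I * ((-(t * r + t * σ / 2) : ℝ) : ℂ)) *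
        Complex.exp (-((t * σ / 2 : ℝ) : ℂ) * Complex.I) := by
    rw [← Complex.exp_add]; congr 1; push_cast; ring
  have h2 : Complex.exp (Complex.I * ((t * -r : ℝ) : ℂ)) =
      Complex.exp (Complex.I * ((-(t * r + t * σ / 2) : ℝ) : ℂ)) *
        Complex.exp (((t * σ / 2 : ℝ) : ℂ) * Complex.I) := by
    rw [← Complex.exp_add]; congr 1; push_cast; ring
  have h3 : ((2 * Real.sin (t * σ / 2) / σ : ℝ) : ℂ) =
      (Complex.exp (-((t * σ / 2 : ℝ) : ℂ) * Complex.I) -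
        Complex.exp (((t * σ / 2 : ℝ) : ℂ) * Complex.I)) * Complex.I / σ := by
    rw [Complex.ofReal_div, Complex.ofReal_mul, Complex.ofReal_sin (t * σ / 2), Complex.sin]
    push_cast
    ring
  rw [h1, h2, h3, show r + σ + -r = σ by ring]
  linear_combination (-(Complex.exp (-((t * σ / 2 : ℝ) : ℂ) * Complex.I) -
        Complex.exp (((t * σ / 2 : ℝ) : ℂ) * Complex.I)) / σ *
      Complex.exp (Complex.I * ((-(t * r + t * σ / 2) : ℝ) : ℂ))) * Complex.I_sq * (-1)

lemma phase_lower (A B u v : ℝ) (hB : 0 ≤ B) (hc : Real.cos (u - v) ≤ 0) :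
    A ≤ ‖(A : ℂ) * Complex.exp (Complex.I * (u : ℂ)) - (B : ℂ) * Complex.exp (Complex.I * (v : ℂ))‖ := by
  have h : (A : ℂ) * Complex.exp (Complex.I * (u : ℂ)) - (B : ℂ) * Complex.exp (Complex.I * (v : ℂ)) =
      Complex.exp (Complex.I * (u : ℂ)) *
        ((A : ℂ) - (B : ℂ) * Complex.exp (((v - u : ℝ) : ℂ) * Complex.I)) := by
    rw [mul_sub, mul_left_comm, ← Complex.exp_add, mul_comm (A : ℂ)]
    congr 3
    push_cast; ring
  rw [h, norm_mul, Complex.norm_exp_I_mul_ofReal, one_mul]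
  refine le_trans ?_ (Complex.re_le_norm _)
  rw [Complex.sub_re, Complex.re_ofReal_mul, Complex.exp_ofReal_mul_I_re, Complex.ofReal_re,
    ← Real.cos_neg, neg_sub]
  nlinarith [mul_nonneg hB (neg_nonneg.2 hc)]

/-- Pointwise lower bound near the cone. -/
lemma Gker_lower (N : ℕ) (a b t s : ℝ) (x y : EuclideanSpace ℝ (Fin N)) (σ : ℝ)
    (ξ : EuclideanSpace ℝ (Fin N)) (ha : 0 < a) (ht : t ∈ Icc a b) (hs : s ∈ Icc a b)
    (hσ : 0 < σ) (hσb : σ * b ≤ 1) (hr : 8 / a ≤ ‖ξ‖)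
    (hc : Real.cos (inner ℝ (x - y) ξ + (t - s) * ‖ξ‖ + (t - s) * σ / 2) ≤ 0) :
    a / (8 * ‖ξ‖) ≤ ‖Gker N t x (‖ξ‖ + σ) ξ - Gker N s y (‖ξ‖ + σ) ξ‖ := by
  set r := ‖ξ‖ with hrdef
  have hr0 : 0 < r := lt_of_lt_of_le (by positivity) hr
  have hsin : ∀ u ∈ Icc a b, a / 2 ≤ 2 * Real.sin (u * σ / 2) / σ := by
    intro u hu
    have hu0 : 0 < u := ha.trans_le hu.1
    have hle : u * σ ≤ 1 := le_trans (by nlinarith [hu.2]) hσb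
    have h := Real.mul_le_sin (x := u * σ / 2) (by positivity) (by linarith [Real.pi_gt_three])
    rw [le_div_iff₀ hσ]
    have hpi : 1 / 2 ≤ 2 / Real.pi := by
      rw [div_le_div_iff₀ (by norm_num) Real.pi_pos]; linarith [Real.pi_le_four]
    have h3 : 1 / 2 * (u * σ / 2) ≤ 2 / Real.pi * (u * σ / 2) := by gcongr
    nlinarith [mul_le_mul_of_nonneg_right hu.1 hσ.le]
  set A := 2 * Real.sin (t * σ / 2) / σ with hA
  set B := 2 * Real.sin (s * σ / 2) / σ with hB
  have hA1 : a / 2 ≤ A := hsin t ht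
  have hB1 : a / 2 ≤ B := hsin s hs
  set ex := Complex.exp (Complex.I * ((-(inner ℝ x ξ) : ℝ) : ℂ)) with hex
  set ey := Complex.exp (Complex.I * ((-(inner ℝ y ξ) : ℝ) : ℂ)) with hey
  have hexn : ‖ex‖ = 1 := Complex.norm_exp_I_mul_ofReal _
  have heyn : ‖ey‖ = 1 := Complex.norm_exp_I_mul_ofReal _
  set u := -(inner ℝ x ξ + t * r + t * σ / 2) with hu
  set v := -(inner ℝ y ξ + s * r + s * σ / 2) with hv
  have hmain := phase_lower A B u v (by linarith) (by
    rw [← Real.cos_neg]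
    convert hc using 2
    rw [hu, hv, inner_sub_left]; ring)
  set Z := (A : ℂ) * Complex.exp (Complex.I * (u : ℂ)) - (B : ℂ) * Complex.exp (Complex.I * (v : ℂ))
    with hZ
  have hx1 : ex * Fker t (r + σ) (-r) = -Complex.I * ((A : ℂ) * Complex.exp (Complex.I * (u : ℂ))) := by
    rw [Fker_neg_eq t r σ hσ.ne', ← hA, hex, mul_left_comm, mul_assoc, ← Complex.exp_add, hu]
    congr 3; push_cast; ring_nf
  have hy1 : ey * Fker s (r + σ) (-r) = -Complex.I * ((B : ℂ) * Complex.exp (Complex.I * (v : ℂ))) := by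
    rw [Fker_neg_eq s r σ hσ.ne', ← hB, hey, mul_left_comm, mul_assoc, ← Complex.exp_add, hv]
    congr 3; push_cast; ring_nf
  have heq : Gker N t x (r + σ) ξ - Gker N s y (r + σ) ξ =
      (2 * (r : ℂ))⁻¹ * (Complex.I * Z -
        (ey * Fker s (r + σ) r - ex * Fker t (r + σ) r)) := by
    rw [Gker_eq, Gker_eq, ← hex, ← hey, ← hrdef, hZ]
    linear_combination (-(2 * (r : ℂ))⁻¹) * (hx1 - hy1)
  have hF : ∀ w : ℝ, ‖Fker w (r + σ) r‖ ≤ 1 / r := by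
    intro w
    refine (Fker_le_two w (r + σ) r (by positivity)).trans ?_
    rw [div_le_div_iff₀ (by positivity) hr0]; linarith
  have herr : ‖ey * Fker s (r + σ) r - ex * Fker t (r + σ) r‖ ≤ 2 / r := by
    refine (norm_sub_le _ _).trans ?_
    rw [norm_mul, norm_mul, hexn, heyn, one_mul, one_mul]
    have := hF t
    have := hF s
    have : 2 / r = 1 / r + 1 / r := by ring
    linarith
  have hrr : 2 / r ≤ a / 4 := by
    rw [div_le_iff₀ ha] at hr
    rw [div_le_div_iff₀ hr0 (by norm_num)]; linarith
  have hlow : a / 4 ≤ ‖Complex.I * Z - (ey * Fker s (r + σ) r - ex * Fker t (r + σ) r)‖ := by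
    have := norm_sub_norm_le (Complex.I * Z) (ey * Fker s (r + σ) r - ex * Fker t (r + σ) r)
    rw [norm_mul, Complex.norm_I, one_mul] at this
    linarith
  rw [heq, norm_mul, norm_inv, norm_mul, Complex.norm_real, Real.norm_of_nonneg hr0.le,
    Complex.norm_ofNat, ← div_eq_inv_mul, le_div_iff₀ (by positivity)]
  refine le_trans (le_of_eq ?_) hlow
  field_simp
  norm_num

/-- Choice of the centre of the good frequency ball. -/
lemma exists_dir (N : ℕ) (hN : 1 ≤ N) (z : EuclideanSpace ℝ (Fin N)) (h : ℝ) :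
    ∃ e : EuclideanSpace ℝ (Fin N), ‖e‖ = 1 ∧
      (inner ℝ z e + h = |h| + ‖z‖ ∨ inner ℝ z e + h = -(|h| + ‖z‖)) := by
  have h1 : ∃ e : EuclideanSpace ℝ (Fin N), ‖e‖ = 1 ∧ inner ℝ z e = ‖z‖ := by
    by_cases hz : z = 0
    · exact ⟨EuclideanSpace.single ⟨0, hN⟩ 1, by simp, by simp [hz]⟩
    · have hz' : ‖z‖ ≠ 0 := norm_ne_zero_iff.2 hz
      refine ⟨‖z‖⁻¹ • z, by rw [norm_smul, norm_inv, norm_norm, inv_mul_cancel₀ hz'], ?_⟩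
      rw [inner_smul_right, real_inner_self_eq_norm_sq]
      field_simp
  obtain ⟨e, he, hz⟩ := h1
  rcases le_total 0 h with hh | hh
  · exact ⟨e, he, Or.inl (by rw [hz, abs_of_nonneg hh]; ring)⟩
  · exact ⟨-e, by rwa [norm_neg], Or.inr (by rw [inner_neg_right, hz, abs_of_nonpos hh]; ring)⟩

lemma cos_near (m : ℕ) (ψ : ℝ) (h : |ψ - (2 * m + 1) * Real.pi| ≤ 3 / 2) : Real.cos ψ ≤ 0 := by
  have e : ψ = (ψ - (2 * m + 1) * Real.pi) + Real.pi + (m : ℝ) * (2 * Real.pi) := by ring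
  rw [e, Real.cos_add_nat_mul_two_pi, Real.cos_add_pi]
  have := abs_le.1 h
  have := Real.cos_nonneg_of_mem_Icc (x := ψ - (2 * m + 1) * Real.pi)
    ⟨by linarith [Real.pi_gt_three], by linarith [Real.pi_gt_three]⟩
  linarith

lemma cos_near' (m : ℕ) (ψ c : ℝ) (hc : c = (2 * m + 1) * Real.pi ∨ c = -((2 * m + 1) * Real.pi))
    (h : |ψ - c| ≤ 3 / 2) : Real.cos ψ ≤ 0 := by
  rcases hc with rfl | rfl
  · exact cos_near m ψ h
  · rw [← Real.cos_neg]
    refine cos_near m _ ?_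
    rw [← abs_neg] at h
    convert h using 2; ring

lemma lower_bound
    (N : ℕ) (hN : 1 ≤ N) (H β : ℝ) (hH1 : 1 / 2 ≤ H)
    (hβ0 : 0 < β)
    (hfun : EuclideanSpace ℝ (Fin N) → ℝ) (hmeas : Measurable hfun)
    (c₁ : ℝ) (hc₁ : 0 < c₁)
    (hflow : ∀ ξ : EuclideanSpace ℝ (Fin N), ξ ≠ 0 → c₁ * ‖ξ‖ ^ (-β) ≤ hfun ξ)
    (a b D : ℝ) (ha : 0 < a) (hab : a < b) :
    ∃ C₁ : ℝ, 0 < C₁ ∧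
      ∀ t s : ℝ, ∀ x y : EuclideanSpace ℝ (Fin N),
        t ∈ Icc a b → s ∈ Icc a b → 0 < |t - s| + ‖x - y‖ → |t - s| + ‖x - y‖ ≤ D →
        ENNReal.ofReal (C₁ * (|t - s| + ‖x - y‖) ^ (2 * H + 1 - N + β)) ≤
            specInt N H hfun (fun τ ξ => Gker N t x τ ξ - Gker N s y τ ξ) := by
  have hb : 0 < b := ha.trans hab
  set γ := 2 * H - 1 with hγ
  have hγ0 : 0 ≤ γ := by rw [hγ]; linarith
  set q := 2 + γ + β with hq
  have hq0 : 0 < q := by positivity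
  obtain ⟨m, hm⟩ := exists_nat_ge (8 * D / a + 1)
  set L := (2 * (m : ℝ) + 1) * Real.pi with hL
  have hm0 : (0 : ℝ) ≤ m := Nat.cast_nonneg m
  have hL0 : 0 < L := by positivity
  have hL1 : 8 * D / a + 1 ≤ L := by nlinarith [Real.pi_gt_three]
  set V := (volume (Metric.ball (0 : EuclideanSpace ℝ (Fin N)) 1)).toReal with hV
  have hVtop : volume (Metric.ball (0 : EuclideanSpace ℝ (Fin N)) 1) ≠ ⊤ :=
    measure_ball_lt_top.ne
  have hV0 : 0 < V := ENNReal.toReal_pos (Metric.measure_ball_pos _ _ one_pos).ne' hVtop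
  set Q := c₁ * a ^ 2 / 64 * 2 ^ (-γ) with hQ
  have hQ0 : 0 < Q := by positivity
  refine ⟨Q * (L + 1) ^ (-q) * (1 / b) * V, by positivity, fun t s x y ht hs hδ0 hδD => ?_⟩
  set δ := |t - s| + ‖x - y‖ with hδ
  obtain ⟨e, he, hdir⟩ := exists_dir N hN (x - y) (t - s)
  rw [← hδ] at hdir
  set ξ₀ := (L / δ) • e with hξ₀
  have hξ₀n : ‖ξ₀‖ = L / δ := by
    rw [hξ₀, norm_smul, he, mul_one, Real.norm_of_nonneg (by positivity)]
  have hLδ : 8 / a + 1 / δ ≤ L / δ := by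
    rw [le_div_iff₀ hδ0, add_mul, one_div, inv_mul_cancel₀ hδ0.ne']
    refine le_trans ?_ hL1
    have : 8 / a * δ ≤ 8 * D / a := by
      rw [div_mul_eq_mul_div]; gcongr
    linarith
  have hts : |t - s| ≤ b := by
    rw [abs_le]; constructor <;> linarith [ht.1, ht.2, hs.1, hs.2]
  have pt : ∀ ξ ∈ Metric.ball ξ₀ (1 / δ), ∀ τ ∈ Ioc ‖ξ‖ (‖ξ‖ + 1 / b),
      Q * ((L + 1) / δ) ^ (-q) ≤
        ‖Gker N t x τ ξ - Gker N s y τ ξ‖ ^ 2 * |τ| ^ (1 - 2 * H) * hfun ξ := by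
    intro ξ hξ τ hτ
    rw [mem_ball_iff_norm] at hξ
    have n1 : |‖ξ‖ - L / δ| ≤ 1 / δ := by
      rw [← hξ₀n]; exact (abs_norm_sub_norm_le _ _).trans hξ.le
    have n2 := abs_le.1 n1
    have hr8 : 8 / a ≤ ‖ξ‖ := by linarith [n2.1]
    have hr0 : 0 < ‖ξ‖ := lt_of_lt_of_le (by positivity) hr8
    have hrU : ‖ξ‖ ≤ (L + 1) / δ := by rw [add_div]; linarith [n2.2]
    have hξ0 : ξ ≠ 0 := norm_pos_iff.1 hr0
    obtain ⟨σ, rfl⟩ : ∃ σ, τ = ‖ξ‖ + σ := ⟨τ - ‖ξ‖, by ring⟩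
    have hσ0 : 0 < σ := by linarith [hτ.1]
    have hσb : σ ≤ 1 / b := by linarith [hτ.2]
    have hσb' : σ * b ≤ 1 := by rwa [le_div_iff₀ hb] at hσb
    have hcos : Real.cos (inner ℝ (x - y) ξ + (t - s) * ‖ξ‖ + (t - s) * σ / 2) ≤ 0 := by
      apply cos_near' m _ (inner ℝ (x - y) ξ₀ + (t - s) * ‖ξ₀‖)
      · rw [hξ₀n, hξ₀, inner_smul_right,
          show L / δ * inner ℝ (x - y) e + (t - s) * (L / δ) =
            L / δ * (inner ℝ (x - y) e + (t - s)) by ring]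
        rcases hdir with h | h
        · left; rw [h, ← hL]; field_simp
        · right; rw [h, ← hL]; field_simp
      · have e1 : inner ℝ (x - y) ξ + (t - s) * ‖ξ‖ + (t - s) * σ / 2 -
            (inner ℝ (x - y) ξ₀ + (t - s) * ‖ξ₀‖) =
            inner ℝ (x - y) (ξ - ξ₀) + (t - s) * (‖ξ‖ - ‖ξ₀‖) + (t - s) * (σ / 2) := by
          rw [inner_sub_right]; ring
        rw [e1]
        refine (abs_add_three _ _ _).trans ?_
        have b1 : |inner ℝ (x - y) (ξ - ξ₀)| ≤ ‖x - y‖ * (1 / δ) :=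
          (abs_real_inner_le_norm _ _).trans (by gcongr)
        have b2 : |(t - s) * (‖ξ‖ - ‖ξ₀‖)| ≤ |t - s| * (1 / δ) := by
          rw [abs_mul, hξ₀n]; gcongr
        have b3 : |(t - s) * (σ / 2)| ≤ 1 / 2 := by
          rw [abs_mul, abs_of_pos (by positivity : 0 < σ / 2)]
          nlinarith
        have b4 : ‖x - y‖ * (1 / δ) + |t - s| * (1 / δ) = 1 := by
          rw [← add_mul, add_comm, ← hδ]; field_simp
        linarith
    have hG := Gker_lower N a b t s x y σ ξ ha ht hs hσ0 hσb' hr8 hcos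
    have hτ2 : ‖ξ‖ + σ ≤ 2 * ‖ξ‖ := by
      have : 1 / b ≤ 8 / a := by
        rw [div_le_div_iff₀ hb ha]; linarith
      linarith
    have hτp : 0 < ‖ξ‖ + σ := by positivity
    have w1 : (2 * ‖ξ‖) ^ (-γ) ≤ |‖ξ‖ + σ| ^ (1 - 2 * H) := by
      rw [abs_of_pos hτp, show 1 - 2 * H = -γ by rw [hγ]; ring]
      exact Real.rpow_le_rpow_of_nonpos hτp hτ2 (by linarith)
    calc Q * ((L + 1) / δ) ^ (-q) ≤ Q * ‖ξ‖ ^ (-q) := by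
          gcongr ?_ * ?_
          exact Real.rpow_le_rpow_of_nonpos hr0 hrU (by linarith)
      _ = (a / (8 * ‖ξ‖)) ^ 2 * (2 * ‖ξ‖) ^ (-γ) * (c₁ * ‖ξ‖ ^ (-β)) := by
          have : ‖ξ‖ ^ (-q) = (‖ξ‖ ^ 2)⁻¹ * ‖ξ‖ ^ (-γ) * ‖ξ‖ ^ (-β) := by
            rw [← Real.rpow_natCast, ← Real.rpow_neg hr0.le, ← Real.rpow_add hr0,
              ← Real.rpow_add hr0, hq]
            congr 1; push_cast; ring
          rw [this, hQ, Real.mul_rpow (by norm_num) hr0.le]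
          field_simp
          norm_num
      _ ≤ _ := by
          gcongr
          exact hflow ξ hξ0
  rw [specInt_swap N H hfun hmeas]
  set W := Q * ((L + 1) / δ) ^ (-q) with hW
  have hW0 : 0 ≤ W := by positivity
  calc ENNReal.ofReal (Q * (L + 1) ^ (-q) * (1 / b) * V * δ ^ (2 * H + 1 - N + β))
      = ENNReal.ofReal W * ENNReal.ofReal (1 / b) * volume (Metric.ball ξ₀ (1 / δ)) := by
        rw [Measure.addHaar_ball_of_pos _ _ (by positivity), ← ENNReal.ofReal_toReal hVtop, ← hV,
          ← ENNReal.ofReal_mul hW0, ← ENNReal.ofReal_mul (by positivity),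
          ← ENNReal.ofReal_mul (by positivity)]
        congr 1
        have e1 : δ ^ (2 * H + 1 - N + β) = δ ^ q * (1 / δ) ^ N := by
          rw [one_div, inv_pow, ← Real.rpow_natCast, ← Real.rpow_neg hδ0.le, ← Real.rpow_add hδ0]
          congr 1; rw [hq, hγ]; ring
        have e2 : ((L + 1) / δ) ^ (-q) = (L + 1) ^ (-q) * δ ^ q := by
          rw [Real.div_rpow (by positivity) hδ0.le, Real.rpow_neg hδ0.le, div_inv_eq_mul]
        rw [e1, hW, e2]
        simp only [finrank_euclideanSpace, Fintype.card_fin]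
        ring
    _ = ∫⁻ ξ in Metric.ball ξ₀ (1 / δ), ENNReal.ofReal W * ENNReal.ofReal (1 / b) := by
        rw [setLIntegral_const]
    _ ≤ ∫⁻ ξ in Metric.ball ξ₀ (1 / δ), ∫⁻ τ : ℝ,
        ENNReal.ofReal (‖Gker N t x τ ξ - Gker N s y τ ξ‖ ^ 2 * |τ| ^ (1 - 2 * H) * hfun ξ) := by
        apply setLIntegral_mono' Metric.isOpen_ball.measurableSet
        intro ξ hξ
        calc ENNReal.ofReal W * ENNReal.ofReal (1 / b)
            = ∫⁻ τ in Ioc ‖ξ‖ (‖ξ‖ + 1 / b), ENNReal.ofReal W := by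
              rw [setLIntegral_const, Real.volume_Ioc]; congr 2; ring
          _ ≤ ∫⁻ τ in Ioc ‖ξ‖ (‖ξ‖ + 1 / b), ENNReal.ofReal
                (‖Gker N t x τ ξ - Gker N s y τ ξ‖ ^ 2 * |τ| ^ (1 - 2 * H) * hfun ξ) :=
              setLIntegral_mono' measurableSet_Ioc
                (fun τ hτ => ENNReal.ofReal_le_ofReal (pt ξ hξ τ hτ))
          _ ≤ _ := setLIntegral_le_lintegral _ _
    _ ≤ _ := setLIntegral_le_lintegral _ _

/-- Proposition 3.1: the variance of the increment `u(t,x) − u(s,y)` of the solution of the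
stochastic wave equation driven by fractional-colored noise is comparable to
`(|t−s| + |x−y|)^{2α}` with `2α = 2H + 1 − N + β`, uniformly on `[a,b] × [−M,M]^N`. -/
theorem variance_increment_two_sided
    (N : ℕ) (hN : 1 ≤ N) (H β : ℝ) (hH1 : 1 / 2 ≤ H) (hH2 : H < 1)
    (hβ0 : 0 < β) (hβN : β < N)
    (hβlow : (N : ℝ) - 2 * H - 1 < β) (hβup : β < (N : ℝ) - 2 * H + 1)
    (hfun : EuclideanSpace ℝ (Fin N) → ℝ) (hmeas : Measurable hfun)
    (c₁ c₂ : ℝ) (hc₁ : 0 < c₁) (hc₁₂ : c₁ ≤ c₂)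
    (hflow : ∀ ξ : EuclideanSpace ℝ (Fin N), ξ ≠ 0 → c₁ * ‖ξ‖ ^ (-β) ≤ hfun ξ)
    (hfup : ∀ ξ : EuclideanSpace ℝ (Fin N), ξ ≠ 0 → hfun ξ ≤ c₂ * ‖ξ‖ ^ (-β))
    (a b M : ℝ) (ha : 0 < a) (hab : a < b) (hM : 0 < M) :
    ∃ C₁ C₂ : ℝ, 0 < C₁ ∧ C₁ ≤ C₂ ∧
      ∀ t s : ℝ, ∀ x y : EuclideanSpace ℝ (Fin N),
        t ∈ Icc a b → s ∈ Icc a b →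
        (∀ i, x i ∈ Icc (-M) M) → (∀ i, y i ∈ Icc (-M) M) →
        ENNReal.ofReal (C₁ * (|t - s| + ‖x - y‖) ^ (2 * H + 1 - N + β)) ≤
            specInt N H hfun (fun τ ξ => Gker N t x τ ξ - Gker N s y τ ξ) ∧
          specInt N H hfun (fun τ ξ => Gker N t x τ ξ - Gker N s y τ ξ) ≤
            ENNReal.ofReal (C₂ * (|t - s| + ‖x - y‖) ^ (2 * H + 1 - N + β)) := by
  have hb : 0 < b := ha.trans hab
  obtain ⟨C₂, hC₂, hup⟩ := upper_bound N hN H β hH1 hH2 hβlow hβup hfun hmeas c₂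
    (hc₁.trans_le hc₁₂) hfup b hb
  obtain ⟨C₁, hC₁, hlo⟩ := lower_bound N hN H β hH1 hβ0 hfun hmeas c₁ hc₁ hflow a b
    (b + N * (2 * M)) ha hab
  refine ⟨C₁, max C₁ C₂, hC₁, le_max_left _ _, fun t s x y ht hs hx hy => ⟨?_, ?_⟩⟩
  · have hδ0 : 0 ≤ |t - s| + ‖x - y‖ := by positivity
    rcases hδ0.eq_or_lt with h | h
    · rw [← h, Real.zero_rpow (by linarith)]; simp
    · refine hlo t s x y ht hs h (add_le_add ?_ ?_)
      · rw [abs_le]; constructor <;> linarith [ht.1, ht.2, hs.1, hs.2]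
      · have h1 : ‖x - y‖ ≤ ∑ i : Fin N, ‖(x - y) i‖ := by
          rw [EuclideanSpace.norm_eq]
          apply Real.sqrt_le_iff.2
          refine ⟨Finset.sum_nonneg fun i _ => norm_nonneg _, ?_⟩
          exact Finset.sum_sq_le_sq_sum_of_nonneg fun i _ => norm_nonneg _
        refine h1.trans ?_
        calc ∑ i : Fin N, ‖(x - y) i‖ ≤ ∑ i : Fin N, 2 * M := by
              apply Finset.sum_le_sum
              intro i _
              rw [Real.norm_eq_abs, PiLp.sub_apply, abs_le]
              have h1 := hx i
              have h2 := hy i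
              constructor <;> linarith [h1.1, h1.2, h2.1, h2.2]
          _ = _ := by simp
  · refine (hup t s x y ⟨ha.le.trans ht.1, ht.2⟩ ⟨ha.le.trans hs.1, hs.2⟩).trans ?_
    apply ENNReal.ofReal_le_ofReal
    gcongr
    exact le_max_right _ _
end

section
/- (Sectorial local nondeterminism in one spatial dimension.) Let N = 1. For every a > 0 there exist constants C > 0 and r₀ > 0 such that for every integer n ≥ 1, all points (t, x), (t¹, x¹), …, (tⁿ, xⁿ) ∈ [a, ∞) × ℝ with max_{1≤j≤n}(|t − t^j| + |x − x^j|) ≤ r₀, and all real numbers a₁, …, aₙ, one has ∫_ℝ ∫_ℝ |𝒢_{t,x}(τ, ξ) − Σ_{j=1}^n a_j 𝒢_{t^j,x^j}(τ, ξ)|² |τ|^{1−2H} h_β(ξ) dξ dτ ≥ C ( min_{1≤j≤n} |(t + x) − (t^j + x^j)|^{2α} + min_{1≤j≤n} |(t − x) − (t^j − x^j)|^{2α} ). -/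
open MeasureTheory Set
open scoped ENNReal

/-- The time–space Fourier transform `𝒢_{t,x}(τ, ξ)` of the wave kernel in one spatial
dimension (`N = 1`). -/
noncomputable def Gker1 (t x : ℝ) (τ ξ : ℝ) : ℂ :=
  (Complex.exp (-Complex.I * ((x * ξ : ℝ) : ℂ)) / (2 * ((|ξ| : ℝ) : ℂ))) *
    ((Complex.exp (-Complex.I * (t : ℂ) * (τ : ℂ)) -
        Complex.exp (Complex.I * (t : ℂ) * ((|ξ| : ℝ) : ℂ))) / ((τ : ℂ) + ((|ξ| : ℝ) : ℂ)) -
      (Complex.exp (-Complex.I * (t : ℂ) * (τ : ℂ)) -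
        Complex.exp (-Complex.I * (t : ℂ) * ((|ξ| : ℝ) : ℂ))) / ((τ : ℂ) - ((|ξ| : ℝ) : ℂ)))

/-- The spectral integral `∫_ℝ ∫_ℝ |f(τ,ξ)|² |τ|^{1−2H} h_β(ξ) dξ dτ` in one spatial
dimension, which (up to a positive constant) gives the variance of the corresponding
linear functional of the solution. -/
noncomputable def specInt1 (H : ℝ) (hfun : ℝ → ℝ) (f : ℝ → ℝ → ℂ) : ℝ≥0∞ :=
  ∫⁻ τ : ℝ, ∫⁻ ξ : ℝ,
    ENNReal.ofReal (‖f τ ξ‖ ^ 2 * |τ| ^ (1 - 2 * H) * hfun ξ)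

/-- Every smooth compactly supported function is the (`2π`-free) Fourier transform of a
rapidly decreasing one. -/
lemma exists_FT (φ : ℝ → ℝ) (h1 : HasCompactSupport φ) (h2 : ContDiff ℝ (⊤ : ℕ∞) φ) :
    ∃ A : ℝ → ℂ, Continuous A ∧ Integrable A ∧
      (∀ s : ℝ, ∫ τ : ℝ, A τ * Complex.exp (-Complex.I * s * τ) = (φ s : ℂ)) ∧
      Integrable (fun u : ℝ => (1 + |u|) ^ 4 * ‖A u‖ ^ 2) := by
  have hpi : (2 * Real.pi) ≠ 0 := by positivity
  let ψ : ℝ → ℂ := fun s => ((φ ((2 * Real.pi) * s) : ℝ) : ℂ)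
  have hψ1 : HasCompactSupport ψ := by
    have h3 : HasCompactSupport (fun s : ℝ => φ ((2 * Real.pi) * s)) := by
      have := h1.comp_homeomorph (Homeomorph.mulLeft₀ (2 * Real.pi) hpi)
      simpa [Function.comp_def] using this
    exact h3.comp_left (g := fun x : ℝ => (x : ℂ)) (by simp)
  have hψ2 : ContDiff ℝ (⊤ : ℕ∞) ψ := by
    have : ContDiff ℝ (⊤ : ℕ∞) (fun s : ℝ => φ ((2 * Real.pi) * s)) :=
      h2.comp (contDiff_const.mul contDiff_id)
    exact Complex.ofRealCLM.contDiff.comp this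
  let S : SchwartzMap ℝ ℂ := hψ1.toSchwartzMap hψ2
  let A : SchwartzMap ℝ ℂ := FourierTransformInv.fourierInv S
  have hA : FourierTransform.fourier A = S := by simp [A]
  refine ⟨A, A.continuous, A.integrable, ?_, ?_⟩
  · intro s
    have h4 : (FourierTransform.fourier A : SchwartzMap ℝ ℂ) (s / (2 * Real.pi)) = (φ s : ℂ) := by
      rw [hA]
      change ((φ ((2 * Real.pi) * (s / (2 * Real.pi))) : ℝ) : ℂ) = _
      rw [mul_div_cancel₀ _ hpi]
    rw [← h4, SchwartzMap.fourier_coe, Real.fourier_real_eq_integral_exp_smul]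
    congr 1
    ext τ
    rw [smul_eq_mul, mul_comm]
    congr 2
    push_cast
    have : (Real.pi : ℂ) ≠ 0 := by exact_mod_cast Real.pi_ne_zero
    field_simp
  · obtain ⟨C, hC⟩ : ∃ C : ℝ, ∀ u : ℝ, (1 + |u|) ^ 3 * ‖A u‖ ≤ C := by
      have := SchwartzMap.one_add_le_sup_seminorm_apply (𝕜 := ℝ) (m := (3, 0)) (k := 3) (n := 0)
        le_rfl le_rfl A
      simp_rw [norm_iteratedFDeriv_zero, Real.norm_eq_abs] at this
      exact ⟨_, this⟩
    refine Integrable.mono' (integrable_inv_one_add_sq.const_mul (C ^ 2)) ?_ ?_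
    · have := A.continuous
      exact Continuous.aestronglyMeasurable (by fun_prop)
    · refine Filter.Eventually.of_forall fun u => ?_
      rw [Real.norm_of_nonneg (by positivity), ← div_eq_mul_inv, le_div_iff₀ (by positivity)]
      have h5 : ((1 + |u|) ^ 3 * ‖A u‖) ^ 2 ≤ C ^ 2 := pow_le_pow_left₀ (by positivity) (hC u) 2
      have h6 : 1 + u ^ 2 ≤ (1 + |u|) ^ 2 := by
        have := abs_nonneg u
        nlinarith [sq_abs u]
      calc (1 + |u|) ^ 4 * ‖A u‖ ^ 2 * (1 + u ^ 2)
          ≤ (1 + |u|) ^ 4 * ‖A u‖ ^ 2 * (1 + |u|) ^ 2 := by gcongr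
        _ = ((1 + |u|) ^ 3 * ‖A u‖) ^ 2 := by ring
        _ ≤ _ := h5

lemma phi_int (t τ ν : ℝ) (h : τ + ν ≠ 0) :
    ∫ s in (0 : ℝ)..t, Complex.exp (-Complex.I * s * τ) * Complex.exp (Complex.I * ν * (t - s)) =
      Complex.I * (Complex.exp (-Complex.I * t * τ) - Complex.exp (Complex.I * t * ν)) /
        ((τ : ℂ) + ν) := by
  have h' : (τ : ℂ) + ν ≠ 0 := by exact_mod_cast h
  have hI := Complex.I_ne_zero
  have hc : (-Complex.I * ((τ : ℂ) + ν)) ≠ 0 := by simp [h']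
  have e1 : ∀ s : ℝ, Complex.exp (-Complex.I * s * τ) * Complex.exp (Complex.I * ν * (t - s)) =
      Complex.exp (Complex.I * t * ν) * Complex.exp ((-Complex.I * ((τ : ℂ) + ν)) * s) := by
    intro s
    rw [← Complex.exp_add, ← Complex.exp_add]
    congr 1
    ring
  simp_rw [e1]
  rw [intervalIntegral.integral_const_mul, integral_exp_mul_complex hc]
  have e2 : Complex.exp (-Complex.I * t * τ) =
    Complex.exp (Complex.I * t * ν) * Complex.exp (-Complex.I * ((τ : ℂ) + ν) * t) := by
    rw [← Complex.exp_add]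
    congr 1
    ring
  rw [e2]
  simp only [Complex.ofReal_zero, mul_zero, Complex.exp_zero]
  field_simp
  rw [Complex.I_sq]
  ring

/-- Multiplying the kernel by `2iξ` gives a time integral of exponentials. -/
lemma Gker_mul (t x τ ξ : ℝ) (h0 : ξ ≠ 0) (h1 : τ + ξ ≠ 0) (h2 : τ - ξ ≠ 0) :
    Gker1 t x τ ξ * (2 * Complex.I * ξ) = Complex.exp (-Complex.I * x * ξ) *
      ((∫ s in (0 : ℝ)..t, Complex.exp (-Complex.I * s * τ) *
          Complex.exp (Complex.I * ξ * (t - s))) -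
       ∫ s in (0 : ℝ)..t, Complex.exp (-Complex.I * s * τ) *
          Complex.exp (Complex.I * ((-ξ : ℝ) : ℂ) * (t - s))) := by
  rw [phi_int t τ ξ h1, phi_int t τ (-ξ) (by rwa [← sub_eq_add_neg])]
  have h0' : (ξ : ℂ) ≠ 0 := by exact_mod_cast h0
  have h1' : (τ : ℂ) + ξ ≠ 0 := by exact_mod_cast h1
  have h2' : (τ : ℂ) - ξ ≠ 0 := by exact_mod_cast h2
  have h2'' : (τ : ℂ) + -ξ ≠ 0 := by rwa [← sub_eq_add_neg]
  unfold Gker1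
  have e1 : (-Complex.I * ((x * ξ : ℝ) : ℂ)) = -Complex.I * x * ξ := by push_cast; ring
  rw [e1]
  have e3 : Complex.I * (t : ℂ) * (-ξ : ℂ) = -Complex.I * t * ξ := by ring
  have e4 : -Complex.I * (t : ℂ) * (-ξ : ℂ) = Complex.I * t * ξ := by ring
  generalize hE : Complex.exp (-Complex.I * x * ξ) = E
  rcases abs_choice ξ with h | h
  · rw [h]
    push_cast
    rw [e3]
    rw [← sub_eq_add_neg]
    field_simp
  · rw [h]
    push_cast
    rw [e3, e4]
    rw [sub_neg_eq_add, ← sub_eq_add_neg]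
    field_simp
    ring

/-- Integrand of the pairing in the variables `(s, (u, ξ))`. -/
noncomputable def Wint (A B : ℝ → ℂ) (r t x c σ s : ℝ) (p : ℝ × ℝ) : ℂ :=
  (A p.1 * Complex.exp (-Complex.I * s * p.1)) *
    (B (r * p.2) * Complex.exp (-Complex.I * ((x + s - σ * (t - s) - c : ℝ) : ℂ) * p.2))

lemma norm_exp_aux (a b : ℝ) : ‖Complex.exp (-Complex.I * a * b)‖ = 1 := by
  have : -Complex.I * (a : ℂ) * b = ((-(a * b) : ℝ) : ℂ) * Complex.I := by push_cast; ring
  rw [this, Complex.norm_exp_ofReal_mul_I]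

lemma Wint_integrable (A B : ℝ → ℂ) (hA : Continuous A) (hB : Continuous B)
    (hAi : Integrable A) (hBi : Integrable B) (r t x c σ : ℝ) (hr : 0 < r) :
    Integrable (Function.uncurry fun (s : ℝ) (p : ℝ × ℝ) => Wint A B r t x c σ s p)
      ((volume.restrict (Ioc 0 t)).prod (volume : Measure (ℝ × ℝ))) := by
  have h1 : Integrable (fun p : ℝ × ℝ => A p.1 * B (r * p.2)) volume :=
    hAi.mul_prod (hBi.comp_mul_left' hr.ne')
  have h2 : Integrable (fun _ : ℝ => (1 : ℂ)) (volume.restrict (Ioc 0 t)) :=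
    integrable_const _
  have h3 := h2.mul_prod h1
  refine h3.mono ?_ ?_
  · refine Continuous.aestronglyMeasurable ?_
    unfold Function.uncurry Wint
    fun_prop
  · refine Filter.Eventually.of_forall fun q => ?_
    simp only [Function.uncurry, Wint, norm_mul, norm_exp_aux]
    simp

lemma Q_eq (A B : ℝ → ℂ) (hA : Continuous A) (hB : Continuous B)
    (hAi : Integrable A) (hBi : Integrable B) (ρ η : ℝ → ℝ)
    (hAρ : ∀ s : ℝ, ∫ τ : ℝ, A τ * Complex.exp (-Complex.I * s * τ) = (ρ s : ℂ))
    (hBη : ∀ s : ℝ, ∫ τ : ℝ, B τ * Complex.exp (-Complex.I * s * τ) = (η s : ℂ))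
    (r t x c σ : ℝ) (hr : 0 < r) (ht : 0 ≤ t) :
    Integrable (fun p : ℝ × ℝ => ∫ s in (0 : ℝ)..t, Wint A B r t x c σ s p) ∧
    ∫ p : ℝ × ℝ, ∫ s in (0 : ℝ)..t, Wint A B r t x c σ s p =
      ∫ s in (0 : ℝ)..t, (ρ s : ℂ) * ((r⁻¹ * η ((x + s - σ * (t - s) - c) / r) : ℝ) : ℂ) := by
  have hW := Wint_integrable A B hA hB hAi hBi r t x c σ hr
  simp_rw [intervalIntegral.integral_of_le ht]
  refine ⟨hW.integral_prod_right, ?_⟩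
  rw [← integral_integral_swap hW]
  congr 1
  ext s
  unfold Wint
  rw [Measure.volume_eq_prod, integral_prod_mul (fun u : ℝ => A u * Complex.exp (-Complex.I * s * u))
    (fun ξ : ℝ => B (r * ξ) *
      Complex.exp (-Complex.I * ((x + s - σ * (t - s) - c : ℝ) : ℂ) * ξ)), hAρ]
  congr 1
  generalize x + s - σ * (t - s) - c = b
  have := Measure.integral_comp_mul_left
    (fun v : ℝ => B v * Complex.exp (-Complex.I * ((b / r : ℝ) : ℂ) * v)) r
  rw [hBη] at this
  rw [abs_of_pos (inv_pos.2 hr)] at this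
  push_cast
  rw [Complex.real_smul] at this
  push_cast at this
  rw [← this]
  congr 1
  ext v
  congr 2
  have : (r : ℂ) ≠ 0 := by exact_mod_cast hr.ne'
  field_simp

/-- The test function in the variables `(u, ξ)`, `u = τ - ξ`. -/
noncomputable def Kfun (A B : ℝ → ℂ) (r c : ℝ) (p : ℝ × ℝ) : ℂ :=
  (2 * Complex.I * p.2) * (Complex.exp (Complex.I * c * p.2) * A p.1 * B (r * p.2))

lemma ae_good : ∀ᵐ p : ℝ × ℝ, p.1 ≠ 0 ∧ p.2 ≠ 0 ∧ p.1 + p.2 ≠ 0 ∧ p.1 + 2 * p.2 ≠ 0 := by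
  have key : ∀ f : ℝ × ℝ → ℝ, Measurable f → (∀ u : ℝ, u ≠ 0 → {ξ : ℝ | f (u, ξ) = 0}.Subsingleton) →
      ∀ᵐ p : ℝ × ℝ, f p ≠ 0 := by
    intro f hf hs
    have hm : MeasurableSet {p : ℝ × ℝ | f p = 0} := hf (measurableSet_singleton 0)
    have : (volume : Measure (ℝ × ℝ)) {p : ℝ × ℝ | f p = 0} = 0 := by
      rw [Measure.volume_eq_prod, Measure.measure_prod_null hm]
      filter_upwards [compl_mem_ae_iff.2 (measure_singleton (0 : ℝ))] with u hu
      exact (hs u hu).measure_zero _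
    rw [ae_iff]
    simpa using this
  have k1 := key (fun p => p.1) (by fun_prop) (fun u hu a ha => absurd ha hu)
  have k2 := key (fun p => p.2) (by fun_prop) (fun u hu a ha b hb => by
    simp only [mem_ofPred_eq] at ha hb; linarith)
  have k3 := key (fun p => p.1 + p.2) (by fun_prop) (fun u hu a ha b hb => by
    simp only [mem_ofPred_eq] at ha hb; linarith)
  have k4 := key (fun p => p.1 + 2 * p.2) (by fun_prop) (fun u hu a ha b hb => by
    simp only [mem_ofPred_eq] at ha hb; linarith)
  filter_upwards [k1, k2, k3, k4] with p h1 h2 h3 h4 using ⟨h1, h2, h3, h4⟩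

lemma Gker_Kfun (A B : ℝ → ℂ) (r t x c : ℝ) (p : ℝ × ℝ) (h1 : p.1 ≠ 0) (h2 : p.2 ≠ 0)
    (h3 : p.1 + 2 * p.2 ≠ 0) :
    Gker1 t x (p.1 + p.2) p.2 * Kfun A B r c p =
      (∫ s in (0 : ℝ)..t, Wint A B r t x c 1 s p) -
        ∫ s in (0 : ℝ)..t, Wint A B r t x c (-1) s p := by
  unfold Kfun
  rw [← mul_assoc, Gker_mul t x (p.1 + p.2) p.2 h2
    (by rwa [add_assoc, ← two_mul]) (by simpa using h1)]
  rw [mul_sub, sub_mul]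
  rw [← intervalIntegral.integral_const_mul, ← intervalIntegral.integral_const_mul,
    ← intervalIntegral.integral_mul_const, ← intervalIntegral.integral_mul_const]
  congr 1 <;>
  · congr 1
    ext s
    unfold Wint
    have : ∀ a b c d e f A B : ℂ, a + b + c + d = e + f →
        Complex.exp a * (Complex.exp b * Complex.exp c) * (Complex.exp d * A * B) =
        A * Complex.exp e * (B * Complex.exp f) := by
      intro a b c d e f A B h
      have h' : Complex.exp a * Complex.exp b * Complex.exp c * Complex.exp d
        = Complex.exp e * Complex.exp f := by
        rw [← Complex.exp_add, ← Complex.exp_add, ← Complex.exp_add, h, Complex.exp_add]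
      linear_combination A * B * h'
    apply this
    push_cast
    ring

/-- The pairing of the kernel with the test function. -/
lemma pairing (A B : ℝ → ℂ) (hA : Continuous A) (hB : Continuous B)
    (hAi : Integrable A) (hBi : Integrable B) (ρ η : ℝ → ℝ)
    (hAρ : ∀ s : ℝ, ∫ τ : ℝ, A τ * Complex.exp (-Complex.I * s * τ) = (ρ s : ℂ))
    (hBη : ∀ s : ℝ, ∫ τ : ℝ, B τ * Complex.exp (-Complex.I * s * τ) = (η s : ℂ))
    (a : ℝ) (hρ : ∀ s, ρ s ≠ 0 → 0 < s ∧ s ≤ a / 2) (hη : ∀ u, 1 ≤ |u| → η u = 0)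
    (r t x t₀ x₀ : ℝ) (hr : 0 < r) (ha : 0 < a) (hr1 : r ≤ a / 2)
    (ht : a ≤ t) (ht₀ : a ≤ t₀) (hd : |t₀ - t| + |x₀ - x| ≤ a / 2) :
    Integrable (fun p : ℝ × ℝ => Gker1 t x (p.1 + p.2) p.2 * Kfun A B r (t₀ + x₀) p) ∧
    ∫ p : ℝ × ℝ, Gker1 t x (p.1 + p.2) p.2 * Kfun A B r (t₀ + x₀) p =
      ((-(r⁻¹ * η (((t + x) - (t₀ + x₀)) / r) * ∫ s, ρ s) : ℝ) : ℂ) := by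
  have ht0 : 0 ≤ t := by linarith
  obtain ⟨i1, q1⟩ := Q_eq A B hA hB hAi hBi ρ η hAρ hBη r t x (t₀ + x₀) 1 hr ht0
  obtain ⟨i2, q2⟩ := Q_eq A B hA hB hAi hBi ρ η hAρ hBη r t x (t₀ + x₀) (-1) hr ht0
  have hae : (fun p : ℝ × ℝ => Gker1 t x (p.1 + p.2) p.2 * Kfun A B r (t₀ + x₀) p) =ᵐ[volume]
      fun p => (∫ s in (0 : ℝ)..t, Wint A B r t x (t₀ + x₀) 1 s p) -
        ∫ s in (0 : ℝ)..t, Wint A B r t x (t₀ + x₀) (-1) s p := by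
    filter_upwards [ae_good] with p hp
    exact Gker_Kfun A B r t x _ p hp.1 hp.2.1 hp.2.2.2
  refine ⟨(i1.sub i2).congr hae.symm, ?_⟩
  rw [integral_congr_ae hae, integral_sub i1 i2, q1, q2]
  have z1 : ∀ s : ℝ, (ρ s : ℂ) *
      ((r⁻¹ * η ((x + s - 1 * (t - s) - (t₀ + x₀)) / r) : ℝ) : ℂ) = 0 := by
    intro s
    by_cases hs : ρ s = 0
    · simp [hs]
    · obtain ⟨s1, s2⟩ := hρ s hs
      rw [hη]
      · simp
      · rw [abs_div, abs_of_pos hr, le_div_iff₀ hr, one_mul, le_abs]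
        right
        have := neg_abs_le (x₀ - x)
        have := abs_nonneg (t₀ - t)
        linarith
  have z2 : ∀ s : ℝ, (ρ s : ℂ) *
      ((r⁻¹ * η ((x + s - (-1) * (t - s) - (t₀ + x₀)) / r) : ℝ) : ℂ) =
      ((ρ s : ℝ) : ℂ) * ((r⁻¹ * η (((t + x) - (t₀ + x₀)) / r) : ℝ) : ℂ) := by
    intro s
    congr 5
    ring
  simp_rw [z1, z2]
  have hR : ∫ s in (0 : ℝ)..t, ρ s = ∫ s, ρ s := by
    apply intervalIntegral.integral_eq_integral_of_support_subset
    intro s hs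
    obtain ⟨s1, s2⟩ := hρ s hs
    exact ⟨s1, by linarith⟩
  rw [intervalIntegral.integral_mul_const, intervalIntegral.integral_ofReal, hR]
  simp
  ring

lemma weight_bound (H β : ℝ) (hH1 : 1 / 2 ≤ H) (hβ0 : 0 < β) (hβup : β < (1 : ℝ) - 2 * H + 1)
    (r u ξ : ℝ) (hr : 0 < r) (hr1 : r ≤ 1) :
    ξ ^ 2 * |u + ξ| ^ (2 * H - 1) * |ξ| ^ β ≤
      (1 + |u|) ^ 4 * ((1 + |r * ξ|) ^ 4 * r ^ (-(1 + 2 * H + β))) := by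
  set q : ℝ := (1 + |r * ξ|) / r with hq
  have hqpos : 0 < q := by positivity
  have hu := abs_nonneg u
  have hx := abs_nonneg ξ
  have hrx : |r * ξ| = r * |ξ| := by rw [abs_mul, abs_of_pos hr]
  have hq1 : 1 + |ξ| ≤ q := by
    rw [hq, le_div_iff₀ hr, hrx]
    nlinarith
  have b1 : ξ ^ 2 ≤ q ^ (2 : ℝ) := by
    rw [Real.rpow_two, ← sq_abs]
    exact pow_le_pow_left₀ hx (by linarith) 2
  have b2 : |ξ| ^ β ≤ q ^ β := Real.rpow_le_rpow hx (by linarith) hβ0.le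
  have b3 : |u + ξ| ^ (2 * H - 1) ≤ (1 + |u|) ^ 4 * q ^ (2 * H - 1) := by
    calc |u + ξ| ^ (2 * H - 1) ≤ ((1 + |u|) * q) ^ (2 * H - 1) := by
          apply Real.rpow_le_rpow (abs_nonneg _) _ (by linarith)
          have := abs_add_le u ξ
          nlinarith
      _ = (1 + |u|) ^ (2 * H - 1) * q ^ (2 * H - 1) :=
          Real.mul_rpow (by positivity) hqpos.le
      _ ≤ (1 + |u|) ^ 4 * q ^ (2 * H - 1) := by
          gcongr
          rw [← Real.rpow_natCast]
          apply Real.rpow_le_rpow_of_exponent_le (by linarith)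
          push_cast
          linarith
  calc ξ ^ 2 * |u + ξ| ^ (2 * H - 1) * |ξ| ^ β
      ≤ q ^ (2 : ℝ) * ((1 + |u|) ^ 4 * q ^ (2 * H - 1)) * q ^ β := by gcongr
    _ = (1 + |u|) ^ 4 * (q ^ (2 : ℝ) * q ^ (2 * H - 1) * q ^ β) := by ring
    _ = (1 + |u|) ^ 4 * q ^ (1 + 2 * H + β) := by
        rw [← Real.rpow_add hqpos, ← Real.rpow_add hqpos]
        congr 2
        ring
    _ = (1 + |u|) ^ 4 * ((1 + |r * ξ|) ^ (1 + 2 * H + β) * r ^ (-(1 + 2 * H + β))) := by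
        rw [hq, Real.div_rpow (by positivity) hr.le, Real.rpow_neg hr.le, div_eq_mul_inv]
    _ ≤ _ := by
        gcongr
        rw [← Real.rpow_natCast]
        apply Real.rpow_le_rpow_of_exponent_le (by linarith [abs_nonneg (r * ξ)])
        push_cast
        linarith

lemma Kfun_norm (A B : ℝ → ℂ) (r c : ℝ) (p : ℝ × ℝ) :
    ‖Kfun A B r c p‖ ^ 2 = 4 * p.2 ^ 2 * ‖A p.1‖ ^ 2 * ‖B (r * p.2)‖ ^ 2 := by
  unfold Kfun
  have : Complex.I * (c : ℂ) * p.2 = ((c * p.2 : ℝ) : ℂ) * Complex.I := by push_cast; ring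
  rw [this]
  simp only [norm_mul, Complex.norm_exp_ofReal_mul_I, Complex.norm_I, Complex.norm_real]
  simp only [Real.norm_eq_abs, mul_pow, sq_abs]
  norm_num
  ring

/-- The dual norm of the test function. -/
lemma J_bound (H β : ℝ) (hH1 : 1 / 2 ≤ H) (hβ0 : 0 < β) (hβup : β < (1 : ℝ) - 2 * H + 1)
    (A B : ℝ → ℂ)
    (hA2 : Integrable (fun u : ℝ => (1 + |u|) ^ 4 * ‖A u‖ ^ 2))
    (hB2 : Integrable (fun u : ℝ => (1 + |u|) ^ 4 * ‖B u‖ ^ 2))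
    (r c : ℝ) (hr : 0 < r) (hr1 : r ≤ 1) :
    ∫⁻ p : ℝ × ℝ, ENNReal.ofReal
      (‖Kfun A B r c p‖ ^ 2 * (|p.1 + p.2| ^ (2 * H - 1) * |p.2| ^ β)) ≤
    ENNReal.ofReal ((4 * (∫ u : ℝ, (1 + |u|) ^ 4 * ‖A u‖ ^ 2) *
      ∫ u : ℝ, (1 + |u|) ^ 4 * ‖B u‖ ^ 2) * r ^ (-(2 + 2 * H + β))) := by
  set f : ℝ → ℝ := fun u : ℝ => (1 + |u|) ^ 4 * ‖A u‖ ^ 2 with hf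
  set g : ℝ → ℝ := fun u : ℝ => (1 + |u|) ^ 4 * ‖B u‖ ^ 2 with hg
  have hgr : Integrable (fun ξ : ℝ => g (r * ξ)) := hB2.comp_mul_left' hr.ne'
  have hprod : Integrable (fun p : ℝ × ℝ => f p.1 * g (r * p.2)) := hA2.mul_prod hgr
  set κ : ℝ := 4 * r ^ (-(1 + 2 * H + β)) with hκ
  have hκ0 : 0 ≤ κ := by positivity
  calc _ ≤ ∫⁻ p : ℝ × ℝ, ENNReal.ofReal (κ * (f p.1 * g (r * p.2))) := by
        apply lintegral_mono
        intro p
        apply ENNReal.ofReal_le_ofReal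
        rw [Kfun_norm]
        have := weight_bound H β hH1 hβ0 hβup r p.1 p.2 hr hr1
        calc _ = (4 * ‖A p.1‖ ^ 2 * ‖B (r * p.2)‖ ^ 2) *
              (p.2 ^ 2 * |p.1 + p.2| ^ (2 * H - 1) * |p.2| ^ β) := by ring
          _ ≤ (4 * ‖A p.1‖ ^ 2 * ‖B (r * p.2)‖ ^ 2) * ((1 + |p.1|) ^ 4 *
              ((1 + |r * p.2|) ^ 4 * r ^ (-(1 + 2 * H + β)))) := by gcongr
          _ = _ := by simp only [hf, hg, hκ]; ring
    _ = ENNReal.ofReal (∫ p : ℝ × ℝ, κ * (f p.1 * g (r * p.2))) := by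
        rw [ofReal_integral_eq_lintegral_ofReal (hprod.const_mul κ)]
        refine Filter.Eventually.of_forall fun p => ?_
        simp only [hf, hg, Pi.zero_apply]
        positivity
    _ = _ := by
        congr 1
        rw [integral_const_mul, Measure.volume_eq_prod,
          integral_prod_mul f (fun ξ => g (r * ξ)), Measure.integral_comp_mul_left,
          abs_of_pos (inv_pos.2 hr), smul_eq_mul, hκ]
        have : r ^ (-(2 + 2 * H + β)) = r ^ (-(1 + 2 * H + β)) * r⁻¹ := by
          rw [← Real.rpow_neg_one r, ← Real.rpow_add hr]
          congr 1
          ring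
        rw [this]
        ring

lemma Gker_meas_s2 (t x : ℝ) : Measurable (fun p : ℝ × ℝ => Gker1 t x p.1 p.2) := by
  unfold Gker1
  have : Measurable (fun p : ℝ × ℝ => |p.2|) := measurable_snd.abs
  fun_prop

lemma Kfun_meas (A B : ℝ → ℂ) (hA : Continuous A) (hB : Continuous B) (r c : ℝ) :
    Measurable (Kfun A B r c) := by
  unfold Kfun
  apply Continuous.measurable
  fun_prop

lemma specInt_shear (H : ℝ) (hfun : ℝ → ℝ) (hmeas : Measurable hfun) (f : ℝ → ℝ → ℂ)
    (hf : Measurable (fun p : ℝ × ℝ => f p.1 p.2)) :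
    specInt1 H hfun f = ∫⁻ p : ℝ × ℝ, ENNReal.ofReal
      (‖f (p.1 + p.2) p.2‖ ^ 2 * |p.1 + p.2| ^ (1 - 2 * H) * hfun p.2) := by
  have hm : Measurable (fun p : ℝ × ℝ => ENNReal.ofReal
      (‖f p.1 p.2‖ ^ 2 * |p.1| ^ (1 - 2 * H) * hfun p.2)) := by
    have : Measurable (fun p : ℝ × ℝ => |p.1|) := measurable_fst.abs
    fun_prop
  have h1 := (measurePreserving_add_prod (volume : Measure ℝ)
    (volume : Measure ℝ)).lintegral_comp hm
  have h2 := lintegral_prod (μ := (volume : Measure ℝ)) (ν := (volume : Measure ℝ)) _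
    hm.aemeasurable
  unfold specInt1
  exact h2.symm.trans h1.symm

/-- Weighted duality inequality. -/
lemma duality (H β c₁ : ℝ) (hc₁ : 0 < c₁) (hfun : ℝ → ℝ)
    (hmeas : Measurable hfun)
    (hflow : ∀ ξ : ℝ, ξ ≠ 0 → c₁ * |ξ| ^ (-β) ≤ hfun ξ)
    (f : ℝ → ℝ → ℂ) (hf : Measurable (fun p : ℝ × ℝ => f p.1 p.2))
    (K : ℝ × ℝ → ℂ) (hK : Measurable K) (M J : ℝ) (hM : 0 < M) (hJ : 0 < J)
    (hMK : ‖∫ p : ℝ × ℝ, f (p.1 + p.2) p.2 * K p‖ = M)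
    (hJK : ∫⁻ p : ℝ × ℝ, ENNReal.ofReal
      (‖K p‖ ^ 2 * (|p.1 + p.2| ^ (2 * H - 1) * |p.2| ^ β)) ≤ ENNReal.ofReal (c₁ * J)) :
    ENNReal.ofReal (M ^ 2 / J) ≤ specInt1 H hfun f := by
  rw [specInt_shear H hfun hmeas f hf]
  set I := ∫⁻ p : ℝ × ℝ, ENNReal.ofReal
      (‖f (p.1 + p.2) p.2‖ ^ 2 * |p.1 + p.2| ^ (1 - 2 * H) * hfun p.2) with hI
  set l : ℝ := J / M with hl
  have hlpos : 0 < l := by positivity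
  have hmp : Measurable (fun p : ℝ × ℝ => ((p.1 + p.2, p.2) : ℝ × ℝ)) := by fun_prop
  have hf' : Measurable (fun p : ℝ × ℝ => f (p.1 + p.2) p.2) := hf.comp hmp
  have hab : Measurable (fun p : ℝ × ℝ => |p.1 + p.2|) := (measurable_fst.add measurable_snd).abs
  have hab2 : Measurable (fun p : ℝ × ℝ => |p.2|) := measurable_snd.abs
  have step1 : ENNReal.ofReal (2 * M) ≤
      ∫⁻ p : ℝ × ℝ, ENNReal.ofReal (2 * (‖f (p.1 + p.2) p.2‖ * ‖K p‖)) := by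
    have h0 : ENNReal.ofReal M ≤
        ∫⁻ p : ℝ × ℝ, ENNReal.ofReal (‖f (p.1 + p.2) p.2‖ * ‖K p‖) := by
      rw [← hMK, ofReal_norm]
      refine (enorm_integral_le_lintegral_enorm _).trans (le_of_eq ?_)
      congr 1
      ext p
      rw [← ofReal_norm, norm_mul]
    simp_rw [ENNReal.ofReal_mul (zero_le_two (α := ℝ))]
    rw [lintegral_const_mul' _ _ ENNReal.ofReal_ne_top]
    gcongr
  have step2 : ∫⁻ p : ℝ × ℝ, ENNReal.ofReal (2 * (‖f (p.1 + p.2) p.2‖ * ‖K p‖)) ≤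
      ∫⁻ p : ℝ × ℝ, (ENNReal.ofReal l * ENNReal.ofReal
        (‖f (p.1 + p.2) p.2‖ ^ 2 * |p.1 + p.2| ^ (1 - 2 * H) * hfun p.2) +
        ENNReal.ofReal (l * c₁)⁻¹ * ENNReal.ofReal
          (‖K p‖ ^ 2 * (|p.1 + p.2| ^ (2 * H - 1) * |p.2| ^ β))) := by
    apply lintegral_mono_ae
    filter_upwards [ae_good] with p hp
    obtain ⟨-, h2, h3, -⟩ := hp
    have hw1 : 0 < |p.1 + p.2| := abs_pos.2 h3
    have hw2 : 0 < |p.2| := abs_pos.2 h2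
    have hfl := hflow p.2 h2
    have hpow : 0 < |p.2| ^ (-β) := Real.rpow_pos_of_pos hw2 _
    have hh : 0 < hfun p.2 := lt_of_lt_of_le (by positivity) hfl
    rw [← ENNReal.ofReal_mul hlpos.le, ← ENNReal.ofReal_mul (by positivity),
      ← ENNReal.ofReal_add (by positivity) (by positivity)]
    apply ENNReal.ofReal_le_ofReal
    have e1 : |p.1 + p.2| ^ (2 * H - 1) = (|p.1 + p.2| ^ (1 - 2 * H))⁻¹ := by
      rw [← Real.rpow_neg hw1.le]
      congr 1
      ring
    have e2 : |p.2| ^ β = (|p.2| ^ (-β))⁻¹ := by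
      rw [← Real.rpow_neg hw2.le, neg_neg]
    rw [e1, e2]
    have hw : 0 < |p.1 + p.2| ^ (1 - 2 * H) := Real.rpow_pos_of_pos hw1 _
    generalize ‖f (p.1 + p.2) p.2‖ = X
    generalize ‖K p‖ = Y
    generalize |p.1 + p.2| ^ (1 - 2 * H) = w at hw
    generalize |p.2| ^ (-β) = z at hpow hfl
    have hlow : l * (X ^ 2 * w * (c₁ * z)) ≤ l * (X ^ 2 * w * hfun p.2) := by gcongr
    have hD : 0 < l * c₁ * w * z := by positivity
    have hsq : l * (X ^ 2 * w * (c₁ * z)) + (l * c₁)⁻¹ * (Y ^ 2 * (w⁻¹ * z⁻¹)) - 2 * (X * Y) =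
        ((l * c₁ * w * z) * X - Y) ^ 2 / (l * c₁ * w * z) := by
      field_simp
      ring
    have : 0 ≤ ((l * c₁ * w * z) * X - Y) ^ 2 / (l * c₁ * w * z) := by positivity
    linarith
  have step3 : ENNReal.ofReal (2 * M) ≤ ENNReal.ofReal l * I + ENNReal.ofReal M := by
    refine (step1.trans step2).trans ?_
    rw [lintegral_add_left (by fun_prop), lintegral_const_mul' _ _ ENNReal.ofReal_ne_top,
      lintegral_const_mul' _ _ ENNReal.ofReal_ne_top]
    gcongr
    refine (mul_le_mul_right hJK _).trans (le_of_eq ?_)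
    rw [← ENNReal.ofReal_mul (by positivity)]
    congr 1
    rw [hl]
    field_simp
  rw [two_mul, ENNReal.ofReal_add hM.le hM.le,
    ENNReal.add_le_add_iff_right ENNReal.ofReal_ne_top] at step3
  have e3 : M ^ 2 / J = l⁻¹ * M := by
    rw [hl]
    field_simp
  rw [e3, ENNReal.ofReal_mul (by positivity), ENNReal.ofReal_inv_of_pos hlpos]
  rw [mul_comm, ← div_eq_mul_inv]
  exact ENNReal.div_le_of_le_mul' step3

/-- The bound in the `t + x` direction. -/
lemma one_sided
    (H β : ℝ) (hH1 : 1 / 2 ≤ H) (hβ0 : 0 < β) (hβup : β < (1 : ℝ) - 2 * H + 1)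
    (c₁ : ℝ) (hc₁ : 0 < c₁) (a : ℝ) (ha : 0 < a) :
    ∃ C r₀ : ℝ, 0 < C ∧ 0 < r₀ ∧
      ∀ (hfun : ℝ → ℝ), Measurable hfun → (∀ ξ : ℝ, ξ ≠ 0 → c₁ * |ξ| ^ (-β) ≤ hfun ξ) →
      ∀ n : ℕ, 1 ≤ n →
        ∀ (t x : ℝ) (ts xs : Fin n → ℝ),
          a ≤ t → (∀ j, a ≤ ts j) →
          (∀ j, |t - ts j| + |x - xs j| ≤ r₀) →
          ∀ coef : Fin n → ℝ,
            ENNReal.ofReal (C * (⨅ j, |(t + x) - (ts j + xs j)| ^ (2 * H + β))) ≤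
              specInt1 H hfun
                (fun τ ξ => Gker1 t x τ ξ - ∑ j, (coef j : ℂ) * Gker1 (ts j) (xs j) τ ξ) := by
  let ρ : ContDiffBump (a / 4 : ℝ) := ⟨a / 16, a / 8, by linarith, by linarith⟩
  let η : ContDiffBump (0 : ℝ) := ⟨1 / 2, 1, by norm_num, by norm_num⟩
  obtain ⟨A, hA, hAi, hAρ, hA2⟩ := exists_FT ρ ρ.hasCompactSupport ρ.contDiff
  obtain ⟨B, hB, hBi, hBη, hB2⟩ := exists_FT η η.hasCompactSupport η.contDiff
  have hρ : ∀ s, ρ s ≠ 0 → 0 < s ∧ s ≤ a / 2 := by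
    intro s hs
    have hs' : s ∈ Function.support ρ := hs
    rw [ρ.support_eq, Metric.mem_ball, Real.dist_eq, abs_lt] at hs'
    have : ρ.rOut = a / 8 := rfl
    rw [this] at hs'
    constructor <;> linarith [hs'.1, hs'.2]
  have hη : ∀ u, 1 ≤ |u| → η u = 0 := by
    intro u hu
    apply η.zero_of_le_dist
    rw [Real.dist_eq, sub_zero]
    exact hu
  have hη0 : η 0 = 1 := η.one_of_mem_closedBall (by simp [η.rIn_pos.le])
  set κ : ℝ := ∫ s, ρ s with hκ
  have hκpos : 0 < κ := ρ.integral_pos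
  set J₀ : ℝ := 4 * (∫ u : ℝ, (1 + |u|) ^ 4 * ‖A u‖ ^ 2) *
      (∫ u : ℝ, (1 + |u|) ^ 4 * ‖B u‖ ^ 2) + 1 with hJ₀
  have hJ₀pos : 0 < J₀ := by
    have i1 : 0 ≤ ∫ u : ℝ, (1 + |u|) ^ 4 * ‖A u‖ ^ 2 := integral_nonneg fun u => by positivity
    have i2 : 0 ≤ ∫ u : ℝ, (1 + |u|) ^ 4 * ‖B u‖ ^ 2 := integral_nonneg fun u => by positivity
    positivity
  refine ⟨κ ^ 2 * c₁ / J₀, min 1 (a / 2), by positivity, by positivity, ?_⟩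
  intro hfun hmeas hflow n hn t x ts xs ht hts hd coef
  have : Nonempty (Fin n) := ⟨⟨0, hn⟩⟩
  obtain ⟨j₀, hj₀⟩ := Finite.exists_min (fun j => |(t + x) - (ts j + xs j)|)
  set r : ℝ := |(t + x) - (ts j₀ + xs j₀)| with hrdef
  have hinf : (⨅ j, |(t + x) - (ts j + xs j)| ^ (2 * H + β)) ≤ r ^ (2 * H + β) :=
    ciInf_le (Set.finite_range _).bddBelow j₀
  have hr0 : 0 ≤ r := abs_nonneg _
  refine (ENNReal.ofReal_le_ofReal (mul_le_mul_of_nonneg_left hinf (by positivity))).trans ?_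
  rcases hr0.eq_or_lt with hr | hr
  · rw [← hr, Real.zero_rpow (by linarith)]
    simp
  have hrle : r ≤ min 1 (a / 2) := by
    refine le_trans ?_ (hd j₀)
    rw [hrdef]
    have : (t + x) - (ts j₀ + xs j₀) = (t - ts j₀) + (x - xs j₀) := by ring
    rw [this]
    exact abs_add_le _ _
  have hr1 : r ≤ 1 := hrle.trans (min_le_left _ _)
  have hr2 : r ≤ a / 2 := hrle.trans (min_le_right _ _)
  have P := pairing A B hA hB hAi hBi ρ η hAρ hBη a hρ hη
  obtain ⟨I0, P0⟩ := P r t x t x hr ha hr2 ht ht (by simp; linarith)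
  have Pj := fun j => P r (ts j) (xs j) t x hr ha hr2 (hts j) ht
    ((hd j).trans (min_le_right _ _))
  have hval : ∫ p : ℝ × ℝ, (Gker1 t x (p.1 + p.2) p.2 -
      ∑ j, (coef j : ℂ) * Gker1 (ts j) (xs j) (p.1 + p.2) p.2) * Kfun A B r (t + x) p =
      ((-(r⁻¹ * κ) : ℝ) : ℂ) := by
    have e : ∀ p : ℝ × ℝ, (Gker1 t x (p.1 + p.2) p.2 -
      ∑ j, (coef j : ℂ) * Gker1 (ts j) (xs j) (p.1 + p.2) p.2) * Kfun A B r (t + x) p =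
      Gker1 t x (p.1 + p.2) p.2 * Kfun A B r (t + x) p -
      ∑ j, (coef j : ℂ) *
        (Gker1 (ts j) (xs j) (p.1 + p.2) p.2 * Kfun A B r (t + x) p) := by
      intro p
      rw [sub_mul, Finset.sum_mul]
      simp_rw [mul_assoc]
    simp_rw [e]
    rw [integral_sub I0 (integrable_finsetSum _ fun j _ => (Pj j).1.const_mul _),
      integral_finsetSum _ (fun j _ => (Pj j).1.const_mul _), P0]
    have z : ∀ j, ∫ p : ℝ × ℝ, (coef j : ℂ) *
        (Gker1 (ts j) (xs j) (p.1 + p.2) p.2 * Kfun A B r (t + x) p) = 0 := by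
      intro j
      rw [integral_const_mul, (Pj j).2, hη]
      · simp
      · rw [abs_div, abs_of_pos hr, le_div_iff₀ hr, one_mul, abs_sub_comm]
        exact hj₀ j
    simp_rw [z]
    simp only [sub_self, zero_div, hη0, Finset.sum_const_zero, sub_zero, mul_one]
    rfl
  have key := duality H β c₁ hc₁ hfun hmeas hflow
    (fun τ ξ => Gker1 t x τ ξ - ∑ j, (coef j : ℂ) * Gker1 (ts j) (xs j) τ ξ)
    ((Gker_meas_s2 t x).sub (Finset.measurable_sum _ fun j _ =>
      (Gker_meas_s2 (ts j) (xs j)).const_mul _))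
    (Kfun A B r (t + x)) (Kfun_meas A B hA hB r (t + x))
    (r⁻¹ * κ) (c₁⁻¹ * (J₀ * r ^ (-(2 + 2 * H + β)))) (by positivity) (by positivity)
    (by
      rw [hval, Complex.norm_real, Real.norm_eq_abs, abs_neg, abs_of_pos (by positivity)])
    (by
      refine (J_bound H β hH1 hβ0 hβup A B hA2 hB2 r (t + x) hr hr1).trans ?_
      apply ENNReal.ofReal_le_ofReal
      rw [← mul_assoc, mul_inv_cancel₀ hc₁.ne', one_mul]
      gcongr
      rw [hJ₀]
      linarith)
  refine le_trans (le_of_eq ?_) key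
  congr 1
  have e4 : r ^ (-(2 + 2 * H + β)) = (r ^ 2 * r ^ (2 * H + β))⁻¹ := by
    rw [← Real.rpow_two, ← Real.rpow_add hr, ← Real.rpow_neg hr.le]
    congr 1
    ring
  rw [e4]
  have : 0 < r ^ (2 * H + β) := Real.rpow_pos_of_pos hr _
  field_simp

lemma Gker_neg (t x τ ξ : ℝ) : Gker1 t x τ (-ξ) = Gker1 t (-x) τ ξ := by
  unfold Gker1
  rw [abs_neg, show x * -ξ = -x * ξ by ring]

lemma specInt_neg (H : ℝ) (hfun : ℝ → ℝ) (f : ℝ → ℝ → ℂ) :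
    specInt1 H hfun f = specInt1 H (fun ξ => hfun (-ξ)) (fun τ ξ => f τ (-ξ)) := by
  unfold specInt1
  congr 1
  ext τ
  exact (lintegral_neg_eq_self (μ := (volume : Measure ℝ)) (fun ξ : ℝ =>
    ENNReal.ofReal (‖f τ ξ‖ ^ 2 * |τ| ^ (1 - 2 * H) * hfun ξ))).symm

/-- Corollary 3.3: sectorial local nondeterminism of the solution of the stochastic wave
equation in one spatial dimension, in the rotated coordinates `(t + x, t − x)`.
Here `2α = 2H + β`. -/
theorem sectorial_LND_one_dim
    (H β : ℝ) (hH1 : 1 / 2 ≤ H) (hH2 : H < 1)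
    (hβ0 : 0 < β) (hβN : β < 1)
    (hβlow : (1 : ℝ) - 2 * H - 1 < β) (hβup : β < (1 : ℝ) - 2 * H + 1)
    (hfun : ℝ → ℝ) (hmeas : Measurable hfun)
    (c₁ c₂ : ℝ) (hc₁ : 0 < c₁) (hc₁₂ : c₁ ≤ c₂)
    (hflow : ∀ ξ : ℝ, ξ ≠ 0 → c₁ * |ξ| ^ (-β) ≤ hfun ξ)
    (hfup : ∀ ξ : ℝ, ξ ≠ 0 → hfun ξ ≤ c₂ * |ξ| ^ (-β))
    (a : ℝ) (ha : 0 < a) :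
    ∃ C r₀ : ℝ, 0 < C ∧ 0 < r₀ ∧
      ∀ n : ℕ, 1 ≤ n →
        ∀ (t x : ℝ) (ts xs : Fin n → ℝ),
          a ≤ t → (∀ j, a ≤ ts j) →
          (∀ j, |t - ts j| + |x - xs j| ≤ r₀) →
          ∀ coef : Fin n → ℝ,
            ENNReal.ofReal (C *
                ((⨅ j, |(t + x) - (ts j + xs j)| ^ (2 * H + β)) +
                  ⨅ j, |(t - x) - (ts j - xs j)| ^ (2 * H + β))) ≤
              specInt1 H hfun
                (fun τ ξ => Gker1 t x τ ξ - ∑ j, (coef j : ℂ) * Gker1 (ts j) (xs j) τ ξ) := by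
  obtain ⟨C, r₀, hC, hr₀, hmain⟩ := one_sided H β hH1 hβ0 hβup c₁ hc₁ a ha
  refine ⟨C / 2, r₀, by positivity, hr₀, ?_⟩
  intro n hn t x ts xs ht hts hd coef
  have h1 := hmain hfun hmeas hflow n hn t x ts xs ht hts hd coef
  have h2 := hmain (fun ξ => hfun (-ξ)) (hmeas.comp measurable_neg)
    (fun ξ hξ => by
      have := hflow (-ξ) (neg_ne_zero.2 hξ)
      rwa [abs_neg] at this) n hn t (-x) ts (fun j => -xs j) ht hts
    (fun j => by
      have : -x - -xs j = -(x - xs j) := by ring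
      rw [this, abs_neg]
      exact hd j) coef
  simp_rw [← Gker_neg] at h2
  rw [← specInt_neg H hfun (fun τ ξ => Gker1 t x τ ξ -
    ∑ j, (coef j : ℂ) * Gker1 (ts j) (xs j) τ ξ)] at h2
  simp_rw [← sub_eq_add_neg] at h2
  set m₁ := ⨅ j, |(t + x) - (ts j + xs j)| ^ (2 * H + β)
  set m₂ := ⨅ j, |(t - x) - (ts j - xs j)| ^ (2 * H + β)
  rcases le_total m₁ m₂ with h | h
  · refine le_trans (ENNReal.ofReal_le_ofReal ?_) h2
    nlinarith
  · refine le_trans (ENNReal.ofReal_le_ofReal ?_) h1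
    nlinarith
end
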